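/- Let n ≥ 2. If a domain U in ℝⁿ is strictly convex, then U is uniquely determined in the class of all domains in ℝⁿ by the condition of local isometry of boundaries in the relative metrics: for every domain V ⊆ ℝⁿ, if there exists a bijective mapping f: ∂_H U → ∂_H V that is a local isometry in the relative metrics of the Hausdorff boundaries, then there exists a Euclidean isometry J: ℝⁿ → ℝⁿ with J(U) = V. -/

import Mathlib

open Set Filter Metric Topology ENNReal

noncomputable section

/-- A domain in `ℝⁿ`: a nonempty open connected set. -/
def IsDomainSet {n : ℕ} (U : Set (EuclideanSpace ℝ (Fin n))) : Prop :=
  IsOpen U ∧ IsConnected U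

/-- The intrinsic distance inside a set `U`: the infimum of lengths of
(continuous) paths joining `a` and `b` inside `U`. -/
def intrinsicDist {n : ℕ} (U : Set (EuclideanSpace ℝ (Fin n)))
    (a b : EuclideanSpace ℝ (Fin n)) : ℝ≥0∞ :=
  ⨅ (γ : ℝ → EuclideanSpace ℝ (Fin n)) (_ : ContinuousOn γ (Icc (0:ℝ) 1))
    (_ : γ 0 = a) (_ : γ 1 = b) (_ : ∀ t ∈ Icc (0:ℝ) 1, γ t ∈ U),
    eVariationOn γ (Icc 0 1)

/-- A sequence which is Cauchy with respect to the intrinsic metric `ρ_U`. -/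
def IntrinsicCauchy {n : ℕ} (U : Set (EuclideanSpace ℝ (Fin n)))
    (x : ℕ → EuclideanSpace ℝ (Fin n)) : Prop :=
  ∀ ε : ℝ≥0∞, 0 < ε → ∃ N, ∀ m ≥ N, ∀ k ≥ N, intrinsicDist U (x m) (x k) < ε

/-- An element of the Hausdorff boundary `∂_H U`, represented by a Cauchy
sequence (in the intrinsic metric of `U`) that does not correspond
to a point of `U`. Two such elements with `hDist a b = 0` represent
the same point of `∂_H U`. -/
structure HPoint {n : ℕ} (U : Set (EuclideanSpace ℝ (Fin n))) where
  seq : ℕ → EuclideanSpace ℝ (Fin n)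
  mem : ∀ k, seq k ∈ U
  cauchy : IntrinsicCauchy U seq
  not_inner : ¬ ∃ u ∈ U, Tendsto (fun k => intrinsicDist U (seq k) u) atTop (𝓝 0)

/-- The relative metric `ρ_{∂_H U, U}` on the Hausdorff boundary. -/
def hDist {n : ℕ} {U : Set (EuclideanSpace ℝ (Fin n))} (a b : HPoint U) : ℝ≥0∞ :=
  Filter.liminf (fun k => intrinsicDist U (a.seq k) (b.seq k)) atTop

/-- `f` represents a bijective mapping `∂_H U → ∂_H V` which is a local
isometry in the relative metrics of the Hausdorff boundaries. -/
def HBoundaryLocalIsometry {n : ℕ} {U V : Set (EuclideanSpace ℝ (Fin n))}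
    (f : HPoint U → HPoint V) : Prop :=
  (∀ a b : HPoint U, hDist a b = 0 ↔ hDist (f a) (f b) = 0) ∧
  (∀ b : HPoint V, ∃ a : HPoint U, hDist (f a) b = 0) ∧
  ∀ w : HPoint U, ∃ ε : ℝ≥0∞, 0 < ε ∧ ∀ a b : HPoint U,
    hDist a w < ε → hDist b w < ε → hDist a b = hDist (f a) (f b)

/-- The support of an element of the Hausdorff boundary: the Euclidean limit
of a representing sequence. -/
def hSupport {n : ℕ} {U : Set (EuclideanSpace ℝ (Fin n))} (a : HPoint U) :
    EuclideanSpace ℝ (Fin n) :=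
  limUnder atTop a.seq

/-- A strictly convex domain: convex, and the open segment joining any two
distinct points of its closure is contained in the domain. -/
def IsStrictlyConvexDomain {n : ℕ} (U : Set (EuclideanSpace ℝ (Fin n))) : Prop :=
  Convex ℝ U ∧ ∀ a ∈ closure U, ∀ b ∈ closure U, a ≠ b → openSegment ℝ a b ⊆ U

section Paths

variable {E : Type*} [PseudoMetricSpace E]

/-- The points `x` and `y` are joined inside `V` by a `1`-Lipschitz path of duration `ℓ`. -/
def HasPath (V : Set E) (x y : E) (ℓ : ℝ) : Prop :=
  0 ≤ ℓ ∧ ∃ γ : ℝ → E, γ 0 = x ∧ γ ℓ = y ∧ (∀ t ∈ Icc 0 ℓ, γ t ∈ V) ∧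
    ∀ s ∈ Icc 0 ℓ, ∀ t ∈ Icc 0 ℓ, dist (γ s) (γ t) ≤ |s - t|

variable {V : Set E} {x y z : E} {ℓ ℓ' : ℝ}

theorem HasPath.of_mem (hx : x ∈ V) (hℓ : 0 ≤ ℓ) : HasPath V x x ℓ :=
  ⟨hℓ, fun _ => x, rfl, rfl, fun _ _ => hx, fun s _ t _ => by simp⟩

theorem HasPath.symm (h : HasPath V x y ℓ) : HasPath V y x ℓ := by
  obtain ⟨h0, γ, h1, h2, h3, h4⟩ := h
  refine ⟨h0, fun t => γ (ℓ - t), by simpa, by simpa, fun t ht => h3 _ ?_, fun s hs t ht => ?_⟩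
  · exact ⟨by linarith [ht.2], by linarith [ht.1]⟩
  · refine (h4 _ ⟨by linarith [hs.2], by linarith [hs.1]⟩ _
      ⟨by linarith [ht.2], by linarith [ht.1]⟩).trans (le_of_eq ?_)
    rw [abs_sub_comm]
    congr 1
    ring

theorem HasPath.trans (h : HasPath V x y ℓ) (h' : HasPath V y z ℓ') :
    HasPath V x z (ℓ + ℓ') := by
  obtain ⟨h0, γ, h1, h2, h3, h4⟩ := h
  obtain ⟨h0', γ', h1', h2', h3', h4'⟩ := h'
  have key : ∀ s ∈ Icc 0 (ℓ + ℓ'), ∀ t ∈ Icc 0 (ℓ + ℓ'), s ≤ t →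
      dist (if s ≤ ℓ then γ s else γ' (s - ℓ)) (if t ≤ ℓ then γ t else γ' (t - ℓ)) ≤ |s - t| := by
    intro s hs t ht hst
    rcases le_or_gt t ℓ with htl | htl
    · rw [if_pos htl, if_pos (hst.trans htl)]
      exact h4 _ ⟨hs.1, hst.trans htl⟩ _ ⟨ht.1, htl⟩
    · rw [if_neg (not_le.2 htl)]
      have htm : t - ℓ ∈ Icc 0 ℓ' := ⟨by linarith, by linarith [ht.2]⟩
      rcases le_or_gt s ℓ with hsl | hsl
      · rw [if_pos hsl]
        have e1 := h4 s ⟨hs.1, hsl⟩ ℓ ⟨h0, le_rfl⟩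
        have e2 := h4' 0 ⟨le_rfl, h0'⟩ (t - ℓ) htm
        have e3 := dist_triangle (γ s) (γ ℓ) (γ' (t - ℓ))
        rw [h2] at e1
        rw [h1'] at e2
        rw [h2] at e3
        rw [abs_of_nonpos (by linarith)] at e1 e2 ⊢
        linarith
      · rw [if_neg (not_le.2 hsl)]
        refine (h4' _ ⟨by linarith, by linarith [hs.2]⟩ _ htm).trans (le_of_eq ?_)
        congr 1
        ring
  refine ⟨by positivity, fun t => if t ≤ ℓ then γ t else γ' (t - ℓ), by simp [h0, h1], ?_,
    fun t ht => ?_, fun s hs t ht => ?_⟩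
  · dsimp only
    split_ifs with h
    · have : ℓ' = 0 := by linarith
      subst this
      rw [h1'] at h2'
      rw [add_zero, h2, h2']
    · simpa using h2'
  · dsimp only
    split_ifs with h
    · exact h3 _ ⟨ht.1, h⟩
    · exact h3' _ ⟨by linarith, by linarith [ht.2]⟩
  · rcases le_total s t with hst | hst
    · exact key s hs t ht hst
    · rw [dist_comm, abs_sub_comm]
      exact key t ht s hs hst

theorem HasPath.right_mem (h : HasPath V x y ℓ) : y ∈ V := by
  obtain ⟨h0, γ, h1, h2, h3, h4⟩ := h
  exact h2 ▸ h3 _ ⟨h0, le_rfl⟩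

theorem HasPath.mono (h : HasPath V x y ℓ) (hl : ℓ ≤ ℓ') : HasPath V x y ℓ' := by
  simpa using h.trans (HasPath.of_mem h.right_mem (sub_nonneg.2 hl))

theorem HasPath.dist_le (h : HasPath V x y ℓ) : dist x y ≤ ℓ := by
  obtain ⟨h0, γ, h1, h2, h3, h4⟩ := h
  simpa [h1, h2, abs_of_nonneg h0] using h4 0 ⟨le_rfl, h0⟩ ℓ ⟨h0, le_rfl⟩

theorem HasPath.restrict {γ : ℝ → E} {s t : ℝ} (hst : s ≤ t) (h3 : ∀ τ ∈ Icc s t, γ τ ∈ V)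
    (h4 : ∀ σ ∈ Icc s t, ∀ τ ∈ Icc s t, dist (γ σ) (γ τ) ≤ |σ - τ|) :
    HasPath V (γ s) (γ t) (t - s) := by
  refine ⟨by linarith, fun τ => γ (s + τ), by simp, by simp, fun τ ht => h3 _ ?_,
    fun σ hs τ ht => ?_⟩
  · exact ⟨by linarith [ht.1], by linarith [ht.2]⟩
  · simpa using h4 (s + σ) ⟨by linarith [hs.1], by linarith [hs.2]⟩ (s + τ)
      ⟨by linarith [ht.1], by linarith [ht.2]⟩

end Paths

section PolygonalPaths

variable {E : Type*} [NormedAddCommGroup E] [NormedSpace ℝ E] {V : Set E} {x y : E}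

theorem HasPath.of_segment (h : segment ℝ x y ⊆ V) : HasPath V x y (dist x y) := by
  rcases eq_or_ne x y with rfl | hne
  · exact HasPath.of_mem (h (left_mem_segment ℝ x x)) dist_nonneg
  have hpos : 0 < dist x y := dist_pos.2 hne
  refine ⟨dist_nonneg, fun t => AffineMap.lineMap x y (t / dist x y), by simp,
    by simp [hpos.ne'], fun t ht => h ?_, fun s hs t ht => ?_⟩
  · rw [segment_eq_image_lineMap]
    exact ⟨_, ⟨div_nonneg ht.1 hpos.le, (div_le_one hpos).2 ht.2⟩, rfl⟩
  · rw [dist_lineMap_lineMap, Real.dist_eq, ← sub_div, abs_div, abs_of_pos hpos,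
      div_mul_cancel₀ _ hpos.ne']

/-- A continuous path inside an open set can be replaced by an inscribed polygonal one. -/
theorem HasPath.of_continuousOn (hV : IsOpen V) {γ : ℝ → E} (hγ : ContinuousOn γ (Icc 0 1))
    (hm : ∀ t ∈ Icc (0 : ℝ) 1, γ t ∈ V) :
    ∃ ℓ, HasPath V (γ 0) (γ 1) ℓ ∧ ENNReal.ofReal ℓ ≤ eVariationOn γ (Icc 0 1) := by
  have hball : ∀ s : Icc (0 : ℝ) 1, ∃ δ > 0, ball (γ s) δ ⊆ V := fun s =>
    Metric.isOpen_iff.1 hV _ (hm s s.2)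
  choose δ hδ hsub using hball
  obtain ⟨t, ht0, htm, ⟨m, hm1⟩, hc⟩ := exists_monotone_Icc_subset_open_cover_Icc
    (zero_le_one (α := ℝ)) (c := fun s : Icc (0 : ℝ) 1 => {τ | γ τ ∈ ball (γ s) (δ s)})
    (fun s => isOpen_ball.preimage (continuousOn_iff_continuous_domRestrict.1 hγ))
    (fun s _ => mem_iUnion.2 ⟨s, mem_ball_self (hδ s)⟩)
  have hstep : ∀ n, HasPath V (γ (t n)) (γ (t (n + 1))) (dist (γ (t n)) (γ (t (n + 1)))) := by
    intro n
    obtain ⟨i, hi⟩ := hc n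
    refine HasPath.of_segment (((convex_ball (γ i) (δ i)).segment_subset ?_ ?_).trans (hsub i))
    · exact hi ⟨le_rfl, htm n.le_succ⟩
    · exact hi ⟨htm n.le_succ, le_rfl⟩
  have hchain : ∀ n, HasPath V (γ (t 0)) (γ (t n))
      (∑ i ∈ Finset.range n, dist (γ (t i)) (γ (t (i + 1)))) := by
    intro n
    induction n with
    | zero => simpa using HasPath.of_mem (hm _ (t 0).2) le_rfl
    | succ n ih =>
      rw [Finset.sum_range_succ]
      exact ih.trans (hstep n)
  refine ⟨∑ i ∈ Finset.range m, dist (γ (t i)) (γ (t (i + 1))), ?_, ?_⟩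
  · have := hchain m
    rwa [ht0, hm1 m le_rfl] at this
  · rw [ENNReal.ofReal_sum_of_nonneg fun _ _ => dist_nonneg]
    refine le_trans (le_of_eq ?_) (eVariationOn.sum_le (f := γ) (s := Icc (0 : ℝ) 1) (n := m)
      (u := fun i => (t i : ℝ)) (fun i j h => htm h) fun i => (t i).2)
    refine Finset.sum_congr rfl fun i _ => ?_
    rw [← edist_dist, edist_comm]

theorem exists_hasPath (hV : IsOpen V) (hc : IsConnected V) (hx : x ∈ V) (hy : y ∈ V) :
    ∃ ℓ, HasPath V x y ℓ := by
  have := ((hV.isConnected_iff_isPathConnected).1 hc).joinedIn x hx y hy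
  obtain ⟨γ, hγ⟩ := this
  obtain ⟨ℓ, h, -⟩ := HasPath.of_continuousOn hV (γ := γ.extend) γ.continuous_extend.continuousOn
    (fun t ht => by rw [Path.extend_apply γ ht]; exact hγ _)
  exact ⟨ℓ, by simpa using h⟩

end PolygonalPaths

section IntrinsicDist

variable {n : ℕ} {V : Set (EuclideanSpace ℝ (Fin n))} {x y z : EuclideanSpace ℝ (Fin n)} {ℓ : ℝ}

theorem HasPath.intrinsicDist_le (h : HasPath V x y ℓ) :
    intrinsicDist V x y ≤ ENNReal.ofReal ℓ := by
  obtain ⟨h0, γ, h1, h2, h3, h4⟩ := h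
  have hmaps : ∀ t ∈ Icc (0 : ℝ) 1, ℓ * t ∈ Icc 0 ℓ := fun t ht =>
    ⟨mul_nonneg h0 ht.1, mul_le_of_le_one_right h0 ht.2⟩
  have hlip : LipschitzOnWith 1 γ (Icc 0 ℓ) := LipschitzOnWith.of_dist_le_mul fun s hs t ht => by
    simpa [Real.dist_eq] using h4 s hs t ht
  have hcont : ContinuousOn (fun t => γ (ℓ * t)) (Icc 0 1) :=
    hlip.continuousOn.comp (by fun_prop) hmaps
  refine (iInf₂_le (fun t => γ (ℓ * t)) hcont).trans ((iInf₂_le (by simpa using h1)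
    (by simpa using h2)).trans ((iInf_le _ fun t ht => h3 _ (hmaps t ht)).trans ?_))
  have := hlip.comp_eVariationOn_le (g := fun t : ℝ => ℓ * t) (s := Icc (0 : ℝ) 1) hmaps
  refine this.trans ?_
  have hmono : MonotoneOn (fun t : ℝ => ℓ * t) (Icc 0 1) := fun a _ b _ hab =>
    mul_le_mul_of_nonneg_left hab h0
  have hv := hmono.eVariationOn_eq (a := 0) (b := 1) (by simp) (by simp)
  simpa using hv.le

theorem hasPath_of_intrinsicDist_lt (hV : IsOpen V)
    (h : intrinsicDist V x y < ENNReal.ofReal ℓ) : HasPath V x y ℓ := by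
  simp only [intrinsicDist, iInf_lt_iff] at h
  obtain ⟨γ, hγ, h0, h1, hm, hlt⟩ := h
  obtain ⟨ℓ', hp, hl⟩ := HasPath.of_continuousOn hV hγ hm
  rw [h0, h1] at hp
  exact hp.mono (ENNReal.ofReal_lt_ofReal_iff'.1 (hl.trans_lt hlt)).1.le

end IntrinsicDist

/-- The metric space `X`, with the inclusion `ι` of `V` and the projection `p` onto the
Euclidean closure of `V`, is a metric space in which `V` is dense and carries its intrinsic
metric. -/
structure IntrinsicModel {E X : Type*} [PseudoMetricSpace E] [MetricSpace X] (V : Set E)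
    (ι : E → X) (p : X → E) : Prop where
  dist_proj_le : ∀ ξ η, dist (p ξ) (p η) ≤ dist ξ η
  proj_incl : ∀ x ∈ V, p (ι x) = x
  dense : ∀ ξ, ∀ ε > 0, ∃ x ∈ V, dist (ι x) ξ < ε
  hasPath : ∀ x ∈ V, ∀ y ∈ V, ∀ ℓ, dist (ι x) (ι y) < ℓ → HasPath V x y ℓ
  dist_le : ∀ x y ℓ, HasPath V x y ℓ → dist (ι x) (ι y) ≤ ℓ

/-- The points of `V`, to be endowed with the intrinsic metric. -/
structure IntrinsicSpace {n : ℕ} (V : Set (EuclideanSpace ℝ (Fin n))) : Type where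
  /-- The underlying point. -/
  val : EuclideanSpace ℝ (Fin n)
  property : val ∈ V

section IntrinsicSpace

variable {n : ℕ} {V : Set (EuclideanSpace ℝ (Fin n))} {x y z : EuclideanSpace ℝ (Fin n)}

theorem intrinsicDist_comm_le (hV : IsOpen V) : intrinsicDist V y x ≤ intrinsicDist V x y := by
  refine le_of_forall_gt fun c hc => ?_
  obtain ⟨r, -, h1, h2⟩ := ENNReal.lt_iff_exists_real_btwn.1 hc
  exact (hasPath_of_intrinsicDist_lt hV h1).symm.intrinsicDist_le.trans_lt h2

theorem intrinsicDist_triangle (hV : IsOpen V) :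
    intrinsicDist V x z ≤ intrinsicDist V x y + intrinsicDist V y z := by
  rcases eq_or_ne (intrinsicDist V x y) ⊤ with h1 | h1
  · simp [h1]
  rcases eq_or_ne (intrinsicDist V y z) ⊤ with h2 | h2
  · simp [h2]
  refine ENNReal.le_of_forall_pos_le_add fun ε hε _ => ?_
  have hε' : (0 : ℝ) < ε / 2 := by positivity
  have key : ∀ u v, intrinsicDist V u v ≠ ⊤ →
      HasPath V u v ((intrinsicDist V u v).toReal + ε / 2) := fun u v huv =>
    hasPath_of_intrinsicDist_lt hV <| (ENNReal.lt_ofReal_iff_toReal_lt huv).2 (by linarith)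
  have := ((key _ _ h1).trans (key _ _ h2)).intrinsicDist_le
  refine this.trans (le_of_eq ?_)
  have e : (intrinsicDist V x y).toReal + ε / 2 + ((intrinsicDist V y z).toReal + ε / 2) =
      ((intrinsicDist V x y).toReal + (intrinsicDist V y z).toReal) + ε := by ring
  rw [e, ENNReal.ofReal_add (by positivity) (by positivity),
    ENNReal.ofReal_add (by positivity) (by positivity), ENNReal.ofReal_toReal h1,
    ENNReal.ofReal_toReal h2, ENNReal.ofReal_coe_nnreal]

/-- The intrinsic metric of a domain. -/
@[reducible]
def intrinsicPseudoMetricSpace (hV : IsDomainSet V) : PseudoMetricSpace (IntrinsicSpace V) :=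
  letI : PseudoEMetricSpace (IntrinsicSpace V) :=
    { edist := fun x y => intrinsicDist V x.val y.val
      edist_self := fun x => by
        simpa using (HasPath.of_mem (ℓ := 0) x.property le_rfl).intrinsicDist_le
      edist_comm := fun x y =>
        (intrinsicDist_comm_le hV.1).antisymm (intrinsicDist_comm_le hV.1)
      edist_triangle := fun x y z => intrinsicDist_triangle hV.1 }
  PseudoEMetricSpace.toPseudoMetricSpace fun x y => by
    obtain ⟨ℓ, hℓ⟩ := exists_hasPath hV.1 hV.2 x.property y.property
    exact (hℓ.intrinsicDist_le.trans_lt ENNReal.ofReal_lt_top).ne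

/-- The completion of a domain with respect to its intrinsic metric is an intrinsic model, whose
points outside the domain are represented by the Hausdorff boundary. -/
theorem exists_intrinsicModel (hV : IsDomainSet V) :
    ∃ (X : Type) (_ : MetricSpace X) (_ : CompleteSpace X) (ι : EuclideanSpace ℝ (Fin n) → X)
      (p : X → EuclideanSpace ℝ (Fin n)) (τ : HPoint V → X), IntrinsicModel V ι p ∧
      (∀ a b, hDist a b = edist (τ a) (τ b)) ∧ ∀ ξ, (∃ a, τ a = ξ) ↔ ξ ∉ ι '' V := by
  let _ := intrinsicPseudoMetricSpace hV
  have hedist : ∀ x y : IntrinsicSpace V, edist x y = intrinsicDist V x.val y.val := fun _ _ => rfl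
  have hpath : ∀ (x y : IntrinsicSpace V) (ℓ : ℝ), dist x y < ℓ → HasPath V x.val y.val ℓ := by
    intro x y ℓ h
    refine hasPath_of_intrinsicDist_lt hV.1 ?_
    rw [← hedist, edist_dist]
    exact (ENNReal.ofReal_lt_ofReal_iff (dist_nonneg.trans_lt h)).2 h
  have hlip : LipschitzWith 1 (fun x : IntrinsicSpace V => x.val) :=
    LipschitzWith.of_dist_le_mul fun x y => by
      rw [NNReal.coe_one, one_mul]
      exact le_of_forall_gt_imp_ge_of_dense fun ℓ hℓ => (hpath x y ℓ hℓ).dist_le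
  obtain ⟨v₀, hv₀⟩ := hV.2.nonempty
  classical
  let inc : EuclideanSpace ℝ (Fin n) → IntrinsicSpace V := fun x =>
    if h : x ∈ V then ⟨x, h⟩ else ⟨v₀, hv₀⟩
  have hinc : ∀ x (h : x ∈ V), inc x = ⟨x, h⟩ := fun x h => dif_pos h
  let ι : EuclideanSpace ℝ (Fin n) → UniformSpace.Completion (IntrinsicSpace V) :=
    fun x => ((inc x : IntrinsicSpace V) : UniformSpace.Completion (IntrinsicSpace V))
  let p : UniformSpace.Completion (IntrinsicSpace V) → EuclideanSpace ℝ (Fin n) :=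
    UniformSpace.Completion.extension (fun x : IntrinsicSpace V => x.val)
  have hι : ∀ x : IntrinsicSpace V, ι x.val = x := fun x => by
    change ((inc x.val : IntrinsicSpace V) : UniformSpace.Completion (IntrinsicSpace V)) = _
    rw [hinc x.val x.property]
  have hιd : ∀ x ∈ V, ∀ y ∈ V, edist (ι x) (ι y) = intrinsicDist V x y := fun x hx y hy => by
    rw [hι ⟨x, hx⟩, hι ⟨y, hy⟩, UniformSpace.Completion.edist_eq, hedist]
  have hdense : ∀ ξ, ∀ ε > 0, ∃ x ∈ V, dist (ι x) ξ < ε := by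
    intro ξ ε hε
    obtain ⟨x, hx⟩ := UniformSpace.Completion.denseRange_coe.exists_dist_lt ξ hε
    exact ⟨x.val, x.property, by rwa [hι, dist_comm]⟩
  have hlim : ∀ a : HPoint V, ∃ ξ, Tendsto (fun k => ι (a.seq k)) atTop (𝓝 ξ) := by
    intro a
    refine cauchySeq_tendsto_of_complete (EMetric.cauchySeq_iff.2 fun ε hε => ?_)
    obtain ⟨N, hN⟩ := a.cauchy ε hε
    exact ⟨N, fun m hm k hk => by
      rw [hιd _ (a.mem _) _ (a.mem _)]
      exact hN m hm k hk⟩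
  choose τ hτ using hlim
  refine ⟨_, inferInstance, inferInstance, ι, p, τ, ⟨?_, ?_, hdense, ?_, ?_⟩, ?_, ?_⟩
  · intro ξ η
    simpa using (hlip.completion_extension).dist_le_mul ξ η
  · intro x hx
    rw [hι ⟨x, hx⟩]
    exact UniformSpace.Completion.extension_coe hlip.uniformContinuous _
  · intro x hx y hy ℓ h
    rw [hι ⟨x, hx⟩, hι ⟨y, hy⟩, UniformSpace.Completion.dist_eq] at h
    exact hpath _ _ ℓ h
  · intro x y ℓ h
    have h' := h.intrinsicDist_le
    rw [← hιd x h.symm.right_mem y h.right_mem, edist_dist] at h'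
    exact (ENNReal.ofReal_le_ofReal_iff h.1).1 h'
  · intro a b
    refine Tendsto.liminf_eq ?_
    refine ((hτ a).edist (hτ b)).congr fun k => ?_
    exact hιd _ (a.mem k) _ (b.mem k)
  · intro ξ
    constructor
    · rintro ⟨a, rfl⟩ ⟨u, hu, hua⟩
      refine a.not_inner ⟨u, hu, ?_⟩
      have h0 := (hτ a).edist (tendsto_const_nhds (x := ι u))
      have h1 : edist (τ a) (ι u) = 0 := by rw [hua, edist_self]
      rw [h1] at h0
      exact h0.congr fun k => hιd _ (a.mem k) _ hu
    · intro hξ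
      have : ∀ k : ℕ, ∃ x ∈ V, dist (ι x) ξ < 1 / (k + 1 : ℝ) := fun k =>
        hdense ξ _ Nat.one_div_pos_of_nat
      choose x hx hxξ using this
      have hx' : Tendsto (fun k => ι (x k)) atTop (𝓝 ξ) :=
        tendsto_iff_dist_tendsto_zero.2 (squeeze_zero (fun _ => dist_nonneg)
          (fun k => (hxξ k).le) tendsto_one_div_add_atTop_nhds_zero_nat)
      let a : HPoint V :=
        { seq := x
          mem := hx
          cauchy := fun ε hε => by
            obtain ⟨N, hN⟩ := EMetric.cauchySeq_iff.1 hx'.cauchySeq ε hε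
            exact ⟨N, fun m hm k hk => by
              rw [← hιd _ (hx _) _ (hx _)]
              exact hN m hm k hk⟩
          not_inner := by
            rintro ⟨u, hu, h⟩
            refine hξ ⟨u, hu, ?_⟩
            have h2 := hx'.edist (tendsto_const_nhds (x := ι u))
            have h3 := tendsto_nhds_unique h2 (h.congr fun k => (hιd _ (hx k) _ hu).symm)
            exact (edist_eq_zero.1 h3).symm }
      exact ⟨a, tendsto_nhds_unique (hτ a) hx'⟩

end IntrinsicSpace

theorem IsPreconnected.subset_of_disjoint_frontier {α : Type*} [TopologicalSpace α] {s W : Set α}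
    (hs : IsPreconnected s) (hW : IsOpen W) (h : ∀ x ∈ s, x ∉ frontier W)
    (hne : (s ∩ W).Nonempty) : s ⊆ W := by
  refine hs.subset_left_of_subset_union hW isClosed_closure.isOpen_compl
    (disjoint_left.2 fun x hx hx' => hx' (subset_closure hx)) (fun x hx => ?_) hne
  by_contra hx'
  simp only [mem_union, mem_compl_iff, not_or, not_not] at hx'
  exact h x hx (by rw [hW.frontier_eq]; exact ⟨hx'.2, hx'.1⟩)

namespace HasPath

variable {E : Type*} [PseudoMetricSpace E] {V W : Set E} {x y : E} {ℓ : ℝ}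

/-- A short path which does not meet the frontier of `W` stays in `W`. -/
theorem of_disjoint_frontier (h : HasPath V x y ℓ) (hW : IsOpen W) (hx : x ∈ W)
    (hd : ∀ z ∈ V, dist z x ≤ ℓ → HasPath V x z ℓ → z ∉ frontier W) : HasPath (V ∩ W) x y ℓ := by
  obtain ⟨h0, γ, h1, h2, h3, h4⟩ := h
  have hcont : ContinuousOn γ (Icc 0 ℓ) :=
    (LipschitzOnWith.of_dist_le_mul (K := 1) fun s hs t ht => by
      simpa [Real.dist_eq] using h4 s hs t ht).continuousOn
  have hsub := (isPreconnected_Icc.image γ hcont).subset_of_disjoint_frontier hW ?_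
    ⟨x, ⟨0, ⟨le_rfl, h0⟩, h1⟩, hx⟩
  · exact ⟨h0, γ, h1, h2, fun t ht => ⟨h3 t ht, hsub ⟨t, ht, rfl⟩⟩, h4⟩
  · rintro _ ⟨t, ht, rfl⟩
    have hp : HasPath V x (γ t) ℓ := by
      have := HasPath.restrict (V := V) (γ := γ) ht.1 (fun τ hτ => h3 τ ⟨hτ.1, hτ.2.trans ht.2⟩)
        (fun σ hσ τ hτ => h4 σ ⟨hσ.1, hσ.2.trans ht.2⟩ τ ⟨hτ.1, hτ.2.trans ht.2⟩)
      rw [h1] at this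
      exact this.mono (by linarith [ht.2])
    refine hd _ (h3 t ht) ?_ hp
    rw [dist_comm]
    exact hp.dist_le

end HasPath

namespace IntrinsicModel

section

variable {E X : Type*} [PseudoMetricSpace E] [MetricSpace X] {V : Set E} {ι : E → X} {p : X → E}

theorem continuous_proj (M : IntrinsicModel V ι p) : Continuous p :=
  (LipschitzWith.of_dist_le_mul (K := 1) (by simpa using M.dist_proj_le)).continuous

theorem dist_le_dist_incl (M : IntrinsicModel V ι p) {x y : E} (hx : x ∈ V) (hy : y ∈ V) :
    dist x y ≤ dist (ι x) (ι y) := by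
  simpa [M.proj_incl x hx, M.proj_incl y hy] using M.dist_proj_le (ι x) (ι y)

end

variable {E X : Type*} [NormedAddCommGroup E] [NormedSpace ℝ E] [MetricSpace X] {V : Set E}
  {ι : E → X} {p : X → E}

theorem dist_incl (M : IntrinsicModel V ι p) {x y : E} (h : segment ℝ x y ⊆ V) :
    dist (ι x) (ι y) = dist x y :=
  (M.dist_le _ _ _ (.of_segment h)).antisymm
    (M.dist_le_dist_incl (h (left_mem_segment ℝ x y)) (h (right_mem_segment ℝ x y)))

theorem incl_proj (M : IntrinsicModel V ι p) (hV : IsOpen V) {ξ : X} (h : p ξ ∈ V) :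
    ι (p ξ) = ξ := by
  obtain ⟨r, hr, hb⟩ := Metric.isOpen_iff.1 hV _ h
  rw [← dist_le_zero]
  refine le_of_forall_pos_le_add fun ε hε => ?_
  obtain ⟨x, hx, hxd⟩ := M.dense ξ (min (ε / 2) r) (by positivity)
  have h1 : dist x (p ξ) < min (ε / 2) r := by
    have := M.dist_proj_le (ι x) ξ
    rw [M.proj_incl x hx] at this
    exact this.trans_lt hxd
  have h2 := M.dist_incl (((convex_ball (p ξ) r).segment_subset
    (mem_ball_self hr) (mem_ball.2 (h1.trans_le (min_le_right _ _)))).trans hb)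
  have h3 := dist_triangle (ι (p ξ)) (ι x) ξ
  rw [h2, dist_comm (p ξ) x] at h3
  have := min_le_left (ε / 2) r
  linarith

theorem proj_mem_iff (M : IntrinsicModel V ι p) (hV : IsOpen V) {ξ : X} :
    p ξ ∈ V ↔ ξ ∈ ι '' V := by
  refine ⟨fun h => ⟨_, h, M.incl_proj hV h⟩, ?_⟩
  rintro ⟨x, hx, rfl⟩
  rwa [M.proj_incl x hx]

theorem exists_proj_eq (M : IntrinsicModel V ι p) [CompleteSpace X] {K : Set E} (hK : Convex ℝ K)
    (hKV : K ⊆ V) {q : E} (hq : q ∈ closure K) :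
    ∃ c, p c = q ∧ ∀ x ∈ K, dist (ι x) c = dist x q := by
  obtain ⟨x, hx, hxq⟩ := mem_closure_iff_seq_limit.1 hq
  have hd : ∀ a ∈ K, ∀ b ∈ K, dist (ι a) (ι b) = dist a b := fun a ha b hb =>
    M.dist_incl ((hK.segment_subset ha hb).trans hKV)
  have hc : CauchySeq fun k => ι (x k) := by
    refine Metric.cauchySeq_iff.2 fun ε hε => ?_
    obtain ⟨N, hN⟩ := Metric.cauchySeq_iff.1 hxq.cauchySeq ε hε
    exact ⟨N, fun m hm k hk => by
      rw [hd _ (hx _) _ (hx _)]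
      exact hN m hm k hk⟩
  obtain ⟨c, hc⟩ := cauchySeq_tendsto_of_complete hc
  refine ⟨c, ?_, fun a ha => ?_⟩
  · refine tendsto_nhds_unique ((M.continuous_proj.tendsto c).comp hc) (hxq.congr fun k => ?_)
    exact (M.proj_incl _ (hKV (hx k))).symm
  · refine tendsto_nhds_unique (tendsto_const_nhds.dist hc)
      ((tendsto_const_nhds.dist hxq).congr fun k => ?_)
    exact (hd a ha _ (hx k)).symm

end IntrinsicModel

theorem exists_mem_dist_lt_of_mem_frontier {E : Type*} [PseudoMetricSpace E] {U : Set E}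
    {z : E} (hz : z ∈ frontier U) {ε : ℝ} (hε : 0 < ε) :
    ∃ x ∈ U, dist x z < ε := by
  obtain ⟨x, hx, h⟩ := Metric.mem_closure_iff.1 (frontier_subset_closure hz) ε hε
  exact ⟨x, hx, by rwa [dist_comm]⟩

theorem IsometryEquiv.frontier_preimage_symm {E : Type*} [PseudoMetricSpace E] (J : E ≃ᵢ E)
    (U : Set E) :
    frontier (J.symm ⁻¹' U) = J.symm ⁻¹' frontier U :=
  (J.symm.toHomeomorph.preimage_frontier U).symm

/-- The map `g` from the frontier of a strictly convex open set `U` onto the boundary of the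
intrinsic model of `V` is bijective and locally isometric. -/
structure LocalBoundaryIsometry {E X : Type*} [NormedAddCommGroup E] [NormedSpace ℝ E]
    [MetricSpace X] (U V : Set E) (ι : E → X) (p : X → E) (g : E → X) : Prop where
  model : IntrinsicModel V ι p
  isOpen_left : IsOpen U
  convex : Convex ℝ U
  openSegment_subset : ∀ a ∈ closure U, ∀ b ∈ closure U, a ≠ b → openSegment ℝ a b ⊆ U
  isOpen_right : IsOpen V
  injOn : InjOn g (frontier U)
  proj_notMem : ∀ z ∈ frontier U, p (g z) ∉ V
  exists_eq : ∀ ξ, p ξ ∉ V → ∃ z ∈ frontier U, g z = ξ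
  isom : ∀ y ∈ frontier U, ∃ ε > 0, ∀ a ∈ frontier U, ∀ b ∈ frontier U, dist a y < ε →
    dist b y < ε → dist (g a) (g b) = dist a b

/-- The isometry `J` extends `g` on the ball of radius `r` about `y` to a local isomorphism of
the pair consisting of `U` and its frontier. -/
structure RegularWith {E X : Type*} [NormedAddCommGroup E] [NormedSpace ℝ E]
    [MetricSpace X] (U V : Set E) (ι : E → X) (g : E → X) (y : E) (r : ℝ) (J : E ≃ᵢ E) :
    Prop where
  pos : 0 < r
  mapsTo : ∀ x ∈ U, dist x y < r → J x ∈ V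
  dist_eq : ∀ z ∈ frontier U, dist z y < r → ∀ x ∈ U, dist x y < r → dist (ι (J x)) (g z) = dist x z

namespace LocalBoundaryIsometry

variable {E X : Type*} [NormedAddCommGroup E] [NormedSpace ℝ E] [MetricSpace X] {U V : Set E}
  {ι : E → X} {p : X → E} {g : E → X} {y z : E} {r : ℝ} {J : E ≃ᵢ E}

theorem continuousOn (H : LocalBoundaryIsometry U V ι p g) : ContinuousOn g (frontier U) := by
  intro y hy
  obtain ⟨ε, hε, h⟩ := H.isom y hy
  refine Metric.continuousWithinAt_iff.2 fun δ hδ => ⟨min δ ε, by positivity, fun z hz hzd => ?_⟩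
  rw [h z hz y hy (hzd.trans_le (min_le_right _ _)) (by simpa)]
  exact hzd.trans_le (min_le_left _ _)

theorem _root_.RegularWith.of_dist_lt (h : RegularWith U V ι g y r J) (hz : dist z y < r) :
    RegularWith U V ι g z (r - dist z y) J := by
  have key : ∀ x, dist x z < r - dist z y → dist x y < r := fun x hx => by
    linarith [dist_triangle x z y]
  exact ⟨by linarith, fun x hx hd => h.mapsTo x hx (key x hd), fun w hw hd x hx hd' =>
    h.dist_eq w hw (key w hd) x hx (key x hd')⟩

theorem proj_eq (H : LocalBoundaryIsometry U V ι p g) (h : RegularWith U V ι g y r J)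
    (hz : z ∈ frontier U) (hzd : dist z y < r) : p (g z) = J z := by
  rw [← dist_le_zero]
  refine le_of_forall_pos_le_add fun ε hε => ?_
  obtain ⟨x, hx, hxz⟩ := exists_mem_dist_lt_of_mem_frontier hz (ε := min (ε / 2) (r - dist z y))
    (lt_min (by positivity) (by linarith))
  have hxr : dist x y < r := by
    linarith [dist_triangle x z y, min_le_right (ε / 2) (r - dist z y)]
  have h1 := H.model.dist_proj_le (ι (J x)) (g z)
  rw [h.dist_eq z hz hzd x hx hxr, H.model.proj_incl _ (h.mapsTo x hx hxr)] at h1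
  have h2 := dist_triangle_left (p (g z)) (J z) (J x)
  rw [J.isometry.dist_eq] at h2
  linarith [min_le_left (ε / 2) (r - dist z y)]

/-- The points of `V` which are intrinsically close to a regular boundary point are covered by
the local isomorphism. -/
theorem symm_mem_of_dist_lt (H : LocalBoundaryIsometry U V ι p g) (h : RegularWith U V ι g y r J)
    (hy : y ∈ frontier U) {v : E} (hv : v ∈ V) (hvd : dist (ι v) (g y) < r) :
    J.symm v ∈ U := by
  obtain ⟨x, hx, hxy⟩ := exists_mem_dist_lt_of_mem_frontier hy
    (ε := (r - dist (ι v) (g y)) / 2) (by linarith)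
  have hxr : dist x y < r := by linarith [dist_nonneg (x := ι v) (y := g y)]
  have h1 := h.dist_eq y hy (by simpa using h.pos) x hx hxr
  have h2 := dist_triangle_right (ι (J x)) (ι v) (g y)
  have h3 := H.model.hasPath _ (h.mapsTo x hx hxr) v hv ((r + dist (ι v) (g y)) / 2) (by linarith)
  have h4 := h3.of_disjoint_frontier (W := J.symm ⁻¹' U)
    (H.isOpen_left.preimage J.symm.continuous) (by simpa) ?_
  · exact h4.right_mem.2
  · intro w hw hwd _ hwf
    rw [J.frontier_preimage_symm] at hwf
    have h5 : dist (J.symm w) y < r := by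
      have := dist_triangle (J.symm w) x y
      have h6 : dist (J.symm w) x = dist w (J x) := by
        rw [← J.isometry.dist_eq, J.apply_symm_apply]
      linarith
    refine H.proj_notMem _ hwf ?_
    rwa [H.proj_eq h hwf h5, J.apply_symm_apply]

theorem symm_proj_mem_closure (H : LocalBoundaryIsometry U V ι p g)
    (h : RegularWith U V ι g y r J) (hy : y ∈ frontier U) {ξ : X} (hξ : dist ξ (g y) < r) :
    J.symm (p ξ) ∈ closure U ∧ dist (J.symm (p ξ)) y ≤ dist ξ (g y) := by
  refine ⟨Metric.mem_closure_iff.2 fun ε hε => ?_, ?_⟩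
  · obtain ⟨v, hv, hvd⟩ := H.model.dense ξ (min ε (r - dist ξ (g y)))
      (lt_min hε (by linarith))
    refine ⟨J.symm v, H.symm_mem_of_dist_lt h hy hv ?_, ?_⟩
    · linarith [dist_triangle (ι v) ξ (g y), min_le_right ε (r - dist ξ (g y))]
    · rw [J.symm.isometry.dist_eq, dist_comm]
      have := H.model.dist_proj_le (ι v) ξ
      rw [H.model.proj_incl v hv] at this
      exact this.trans_lt (hvd.trans_le (min_le_left _ _))
  · have := H.model.dist_proj_le ξ (g y)
    rwa [H.proj_eq h hy (by simpa using h.pos), ← J.symm.isometry.dist_eq,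
      J.symm_apply_apply] at this

/-- The map `g` is open at regular points. -/
theorem exists_eq_of_dist_lt (H : LocalBoundaryIsometry U V ι p g)
    (h : RegularWith U V ι g y r J) (hy : y ∈ frontier U) {ξ : X} (hξ : dist ξ (g y) < r)
    (hξV : p ξ ∉ V) : ∃ u ∈ frontier U, dist u y < r ∧ g u = ξ := by
  obtain ⟨h1, h2⟩ := H.symm_proj_mem_closure h hy hξ
  have hur : dist (J.symm (p ξ)) y < r := h2.trans_lt hξ
  have hu : J.symm (p ξ) ∈ frontier U := by
    rw [H.isOpen_left.frontier_eq]
    refine ⟨h1, fun hu => hξV ?_⟩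
    simpa using h.mapsTo _ hu hur
  refine ⟨_, hu, hur, ?_⟩
  rw [← dist_le_zero]
  refine le_of_forall_pos_le_add fun ε hε => ?_
  obtain ⟨v, hv, hvd⟩ := H.model.dense ξ (min (ε / 2) (r - dist ξ (g y)))
    (lt_min (by positivity) (by linarith))
  have hvr : dist (ι v) (g y) < r := by
    linarith [dist_triangle (ι v) ξ (g y), min_le_right (ε / 2) (r - dist ξ (g y))]
  have hvU := H.symm_mem_of_dist_lt h hy hv hvr
  have h3 := (H.symm_proj_mem_closure h hy hvr).2
  rw [H.model.proj_incl v hv] at h3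
  have h4 := h.dist_eq _ hu hur _ hvU (h3.trans_lt hvr)
  rw [J.apply_symm_apply, J.symm.isometry.dist_eq] at h4
  have h5 := H.model.dist_proj_le (ι v) ξ
  rw [H.model.proj_incl v hv] at h5
  linarith [dist_triangle_left (g (J.symm (p ξ))) ξ (ι v), min_le_left (ε / 2) (r - dist ξ (g y))]

end LocalBoundaryIsometry

namespace LocalBoundaryIsometry

variable {E X : Type*} [NormedAddCommGroup E] [NormedSpace ℝ E] [MetricSpace X] {U V : Set E}
  {ι : E → X} {p : X → E} {g : E → X}

theorem _root_.dist_lineMap_lineMap_left {E : Type*} [NormedAddCommGroup E] [NormedSpace ℝ E]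
    (x y y' : E) {θ : ℝ} (h0 : 0 ≤ θ) :
    dist (AffineMap.lineMap x y θ) (AffineMap.lineMap x y' θ) = θ * dist y y' := by
  rw [AffineMap.lineMap_apply_module', AffineMap.lineMap_apply_module', dist_add_right,
    dist_smul₀, dist_sub_right, Real.norm_of_nonneg h0]

/-- A limit of segments contained in `V` and swept by a path in `V` is contained in `V`, as soon
as it touches the boundary at regular points only. -/
theorem segment_subset_of_forall_lt (H : LocalBoundaryIsometry U V ι p g) [CompleteSpace X]
    {x : E} {γ : ℝ → E} {s₀ ℓ : ℝ} (hs₀ : 0 < s₀) (hsℓ : s₀ ≤ ℓ) (hx : x ∈ V) (hγ0 : γ 0 = x)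
    (hγV : γ s₀ ∈ V)
    (hγ : ∀ s ∈ Icc 0 ℓ, ∀ t ∈ Icc 0 ℓ, dist (γ s) (γ t) ≤ |s - t|) {K : Set E}
    (hK : Convex ℝ K) (hxK : x ∈ K) (hγK : γ s₀ ∈ K)
    (hB : ∀ z ∈ frontier U, dist (ι x) (g z) ≤ ℓ → p (g z) ∈ K →
      ∃ r J, RegularWith U V ι g z r J)
    (hS : ∀ s ∈ Ico 0 s₀, segment ℝ x (γ s) ⊆ V) : segment ℝ x (γ s₀) ⊆ V := by
  set σ : ℝ → ℝ → E := fun s θ => AffineMap.lineMap x (γ s) θ with hσ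
  have hσV : ∀ s ∈ Ico 0 s₀, ∀ θ ∈ Icc (0 : ℝ) 1, σ s θ ∈ V := fun s hs θ hθ => hS s hs (by
    rw [segment_eq_image_lineMap]
    exact ⟨θ, hθ, rfl⟩)
  have hIcc : ∀ s ∈ Ico 0 s₀, s ∈ Icc 0 ℓ := fun s hs => ⟨hs.1, hs.2.le.trans hsℓ⟩
  have hσd : ∀ s ∈ Icc 0 ℓ, ∀ t ∈ Icc 0 ℓ, ∀ θ ∈ Icc (0 : ℝ) 1,
      dist (σ s θ) (σ t θ) ≤ |s - t| := by
    intro s hs t ht θ hθ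
    rw [dist_lineMap_lineMap_left _ _ _ hθ.1]
    exact (mul_le_of_le_one_left dist_nonneg hθ.2).trans (hγ s hs t ht)
  have hsweep : ∀ s ∈ Ico 0 s₀, ∀ t ∈ Ico 0 s₀, ∀ θ ∈ Icc (0 : ℝ) 1, s ≤ t →
      dist (ι (σ s θ)) (ι (σ t θ)) ≤ t - s := by
    intro s hs t ht θ hθ hst
    have hsub : ∀ τ ∈ Icc s t, τ ∈ Ico 0 s₀ := fun τ hτ => ⟨hs.1.trans hτ.1, hτ.2.trans_lt ht.2⟩
    exact H.model.dist_le _ _ _ (HasPath.restrict (γ := fun τ => σ τ θ) hst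
      (fun τ hτ => hσV τ (hsub τ hτ) θ hθ)
      fun a ha b hb => hσd a (hIcc a (hsub a ha)) b (hIcc b (hsub b hb)) θ hθ)
  have hsweep' : ∀ s ∈ Ico 0 s₀, ∀ t ∈ Ico 0 s₀, ∀ θ ∈ Icc (0 : ℝ) 1,
      dist (ι (σ s θ)) (ι (σ t θ)) ≤ dist s t := by
    intro s hs t ht θ hθ
    rcases le_total s t with hst | hst
    · rw [dist_comm s, Real.dist_eq, abs_of_nonneg (by linarith)]
      exact hsweep s hs t ht θ hθ hst
    · rw [Real.dist_eq, abs_of_nonneg (by linarith), dist_comm]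
      exact hsweep t ht s hs θ hθ hst
  obtain ⟨s, -, hs, hslim⟩ := exists_seq_strictMono_tendsto' hs₀
  have hs' : ∀ k, s k ∈ Ico 0 s₀ := fun k => Ioo_subset_Ico_self (hs k)
  have hlim : ∀ θ ∈ Icc (0 : ℝ) 1, ∃ c, Tendsto (fun k => ι (σ (s k) θ)) atTop (𝓝 c) := by
    intro θ hθ
    refine cauchySeq_tendsto_of_complete (Metric.cauchySeq_iff.2 fun ε hε => ?_)
    obtain ⟨N, hN⟩ := Metric.cauchySeq_iff.1 hslim.cauchySeq ε hε
    exact ⟨N, fun m hm k hk => (hsweep' _ (hs' m) _ (hs' k) θ hθ).trans_lt (hN m hm k hk)⟩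
  have : Nonempty X := ⟨ι x⟩
  choose! c hc using hlim
  have hσlim : ∀ θ ∈ Icc (0 : ℝ) 1, Tendsto (fun k => σ (s k) θ) atTop (𝓝 (σ s₀ θ)) := by
    intro θ hθ
    refine tendsto_iff_dist_tendsto_zero.2 (squeeze_zero (fun _ => dist_nonneg)
      (fun k => hσd _ (hIcc _ (hs' k)) _ ⟨hs₀.le, hsℓ⟩ θ hθ) ?_)
    simpa [Real.dist_eq] using tendsto_iff_dist_tendsto_zero.1 hslim
  have hpc : ∀ θ ∈ Icc (0 : ℝ) 1, p (c θ) = σ s₀ θ := fun θ hθ =>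
    tendsto_nhds_unique ((H.model.continuous_proj.tendsto _).comp (hc θ hθ))
      ((hσlim θ hθ).congr fun k => (H.model.proj_incl _ (hσV _ (hs' k) θ hθ)).symm)
  have hcd : ∀ θ ∈ Icc (0 : ℝ) 1, ∀ θ' ∈ Icc (0 : ℝ) 1,
      dist (c θ) (c θ') = dist (σ s₀ θ) (σ s₀ θ') := by
    intro θ hθ θ' hθ'
    refine tendsto_nhds_unique ((hc θ hθ).dist (hc θ' hθ'))
      (((hσlim θ hθ).dist (hσlim θ' hθ')).congr fun k => (H.model.dist_incl ?_).symm)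
    refine Subset.trans ((convex_segment x (γ (s k))).segment_subset ?_ ?_) (hS _ (hs' k)) <;>
    · rw [segment_eq_image_lineMap]
      exact ⟨_, ‹_›, rfl⟩
  have hc0 : c 0 = ι x := tendsto_nhds_unique (hc 0 (by simp)) (by simp [hσ])
  intro q hq
  rw [segment_eq_image_lineMap] at hq
  obtain ⟨θ, hθ, rfl⟩ := hq
  by_contra hqV
  change σ s₀ θ ∉ V at hqV
  have hθ0 : 0 < θ := lt_of_le_of_ne hθ.1 (by
    rintro rfl
    simp [hσ, hx] at hqV)
  have hθ1 : θ < 1 := lt_of_le_of_ne hθ.2 (by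
    rintro rfl
    simp [hσ, hγV] at hqV)
  have hD : 0 < dist x (γ s₀) := dist_pos.2 (by
    intro h
    simp [hσ, ← h, hx] at hqV)
  have hDs : dist x (γ s₀) ≤ s₀ := by
    have := hγ 0 ⟨le_rfl, hs₀.le.trans hsℓ⟩ s₀ ⟨hs₀.le, hsℓ⟩
    rwa [hγ0, zero_sub, abs_neg, abs_of_pos hs₀] at this
  obtain ⟨w, hw, hwc⟩ := H.exists_eq (c θ) (by rwa [hpc θ hθ])
  obtain ⟨r, J, hR⟩ := hB w hw (by
    rw [hwc, ← hc0, hcd 0 (by simp) θ hθ, dist_lineMap_lineMap, dist_zero_left,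
      Real.norm_of_nonneg hθ.1]
    nlinarith) (by
    rw [hwc, hpc θ hθ]
    exact hK.segment_subset hxK hγK (by
      rw [segment_eq_image_lineMap]
      exact ⟨θ, hθ, rfl⟩))
  obtain ⟨η, hη0, hη⟩ : ∃ η > 0, η ≤ θ ∧ η ≤ 1 - θ ∧ η * dist x (γ s₀) < r := by
    have hr := hR.pos
    refine ⟨min (min θ (1 - θ)) (r / (2 * dist x (γ s₀))), ?_, ?_, ?_, ?_⟩
    · exact lt_min (lt_min hθ0 (by linarith)) (by positivity)
    · exact (min_le_left _ _).trans (min_le_left _ _)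
    · exact (min_le_left _ _).trans (min_le_right _ _)
    · refine (mul_le_mul_of_nonneg_right (min_le_right _ _) hD.le).trans_lt ?_
      rw [div_mul_eq_mul_div, div_lt_iff₀ (by positivity)]
      nlinarith [mul_pos hr hD]
  have h1 : θ - η ∈ Icc (0 : ℝ) 1 := ⟨by linarith, by linarith⟩
  have h2 : θ + η ∈ Icc (0 : ℝ) 1 := ⟨by linarith, by linarith⟩
  have hcl : ∀ t ∈ Icc (0 : ℝ) 1, |t - θ| = η → J.symm (σ s₀ t) ∈ closure U := by
    intro t ht htη
    rw [← hpc t ht]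
    refine (H.symm_proj_mem_closure hR hw ?_).1
    rw [hwc, hcd t ht θ hθ, dist_lineMap_lineMap, Real.dist_eq, htη]
    exact hη.2.2
  have e1 := hcl _ h1 (by simp [abs_of_pos hη0])
  have e2 := hcl _ h2 (by simp [abs_of_pos hη0])
  have hne : J.symm (σ s₀ (θ - η)) ≠ J.symm (σ s₀ (θ + η)) := by
    refine J.symm.injective.ne (dist_pos.1 ?_)
    rw [dist_lineMap_lineMap, Real.dist_eq]
    have : θ - η - (θ + η) ≠ 0 := by intro h; linarith
    positivity
  have hmid : midpoint ℝ (J.symm (σ s₀ (θ - η))) (J.symm (σ s₀ (θ + η))) = w := by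
    rw [← J.symm.map_midpoint]
    have : midpoint ℝ (σ s₀ (θ - η)) (σ s₀ (θ + η)) = σ s₀ θ := by
      rw [hσ, ← AffineMap.map_midpoint, midpoint_sub_add]
    rw [this, ← hpc θ hθ, ← hwc, H.proj_eq hR hw (by simpa using hR.pos), J.symm_apply_apply]
  have hwU : w ∈ U := by
    rw [← hmid]
    exact H.openSegment_subset _ e1 _ e2 hne (midpoint_mem_openSegment _ _)
  exact (H.isOpen_left.frontier_eq ▸ hw).2 hwU

/-- If a path in `V`, starting at `x`, stays in a convex set which contains no irregular boundary
point at intrinsic distance at most the length of the path, then the points of the path are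
visible from `x` inside `V`. -/
theorem segment_subset (H : LocalBoundaryIsometry U V ι p g) [CompleteSpace X]
    {x : E} {γ : ℝ → E} {ℓ : ℝ} (hγ0 : γ 0 = x) (hγV : ∀ t ∈ Icc 0 ℓ, γ t ∈ V)
    (hγ : ∀ s ∈ Icc 0 ℓ, ∀ t ∈ Icc 0 ℓ, dist (γ s) (γ t) ≤ |s - t|) {K : Set E}
    (hK : Convex ℝ K) (hγK : ∀ t ∈ Icc 0 ℓ, γ t ∈ K)
    (hB : ∀ z ∈ frontier U, dist (ι x) (g z) ≤ ℓ → p (g z) ∈ K →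
      ∃ r J, RegularWith U V ι g z r J) {s : ℝ} (hs : s ∈ Icc 0 ℓ) : segment ℝ x (γ s) ⊆ V := by
  have h0 : (0 : ℝ) ∈ Icc 0 ℓ := ⟨le_rfl, hs.1.trans hs.2⟩
  have hx : x ∈ V := hγ0 ▸ hγV 0 h0
  have hxK : x ∈ K := hγ0 ▸ hγK 0 h0
  set S : Set ℝ := {s | ∀ τ ∈ Icc 0 s, segment ℝ x (γ τ) ⊆ V} with hS
  have key : Icc 0 ℓ ⊆ S := by
    refine IsClosed.Icc_subset_of_forall_mem_nhdsWithin ?_ ?_ ?_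
    · refine IsSeqClosed.isClosed fun t a ht hta => ?_
      have ha : a ∈ Icc 0 ℓ := isClosed_Icc.mem_of_tendsto hta (.of_forall fun k => (ht k).2)
      have hlt : ∀ τ ∈ Ico 0 a, segment ℝ x (γ τ) ⊆ V := by
        intro τ hτ
        obtain ⟨k, hk⟩ := (hta.eventually (lt_mem_nhds hτ.2)).exists
        exact (ht k).1 τ ⟨hτ.1, hk.le⟩
      refine ⟨fun τ hτ => ?_, ha⟩
      rcases hτ.2.lt_or_eq with h | rfl
      · exact hlt τ ⟨hτ.1, h⟩
      · rcases hτ.1.eq_or_lt with h | h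
        · simpa [← h, hγ0] using hx
        · exact H.segment_subset_of_forall_lt h ha.2 hx hγ0 (hγV _ ha) hγ hK hxK (hγK _ ha) hB hlt
    · intro τ hτ
      obtain rfl : τ = 0 := le_antisymm hτ.2 hτ.1
      simpa [hγ0] using hx
    · rintro s ⟨hsS, hs⟩
      have hc : IsCompact (segment ℝ x (γ s)) := by
        rw [segment_eq_image_lineMap]
        exact isCompact_Icc.image AffineMap.lineMap_continuous
      obtain ⟨δ, hδ, hsub⟩ := hc.exists_thickening_subset_open H.isOpen_right
        (hsS s ⟨hs.1, le_rfl⟩)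
      have hnhds : Ioo s (min (s + δ) ℓ) ∈ 𝓝[>] s := Ioo_mem_nhdsGT (lt_min (by linarith) hs.2)
      filter_upwards [hnhds] with t ht τ hτ
      rcases le_or_gt τ s with h | h
      · exact hsS τ ⟨hτ.1, h⟩
      intro q hq
      rw [segment_eq_image_lineMap] at hq
      obtain ⟨θ, hθ, rfl⟩ := hq
      refine hsub (mem_thickening_iff.2 ⟨AffineMap.lineMap x (γ s) θ, ?_, ?_⟩)
      · rw [segment_eq_image_lineMap]
        exact ⟨θ, hθ, rfl⟩
      · rw [dist_lineMap_lineMap_left _ _ _ hθ.1]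
        have h1 := hγ τ ⟨hτ.1, hτ.2.trans (ht.2.le.trans (min_le_right _ _))⟩ s
          ⟨hs.1, hs.2.le⟩
        rw [abs_of_pos (by linarith)] at h1
        have h2 := mul_le_of_le_one_left (dist_nonneg (x := γ τ) (y := γ s)) hθ.2
        linarith [hτ.2, ht.2.trans_le (min_le_left (s + δ) ℓ)]
  exact key hs s ⟨hs.1, le_rfl⟩

end LocalBoundaryIsometry

section StrictlyConvex

variable {E : Type*} [NormedAddCommGroup E] [NormedSpace ℝ E] {U : Set E}

/-- The ray from an interior point, if it leaves the set, meets the frontier. -/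
theorem exists_pos_add_smul_mem_frontier {x e : E} (hU : IsOpen U) (hx : x ∈ U)
    (h : ∃ t : ℝ, 0 ≤ t ∧ x + t • e ∉ U) : ∃ t : ℝ, 0 < t ∧ x + t • e ∈ frontier U := by
  by_contra! hcon
  obtain ⟨t, ht, htU⟩ := h
  have hpre : IsPreconnected ((fun t : ℝ => x + t • e) '' Ici 0) :=
    isPreconnected_Ici.image _ (by fun_prop)
  refine htU (hpre.subset_of_disjoint_frontier hU ?_ ⟨x, ⟨0, by simp⟩, hx⟩ ⟨t, ht, rfl⟩)
  rintro _ ⟨s, hs, rfl⟩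
  rcases (mem_Ici.1 hs).eq_or_lt with rfl | h
  · simpa [hU.frontier_eq] using fun _ => hx
  · exact hcon s h

/-- Near a boundary point of a strictly convex open set, the set is covered by short chords. -/
theorem exists_forall_mem_openSegment [FiniteDimensional ℝ E] (hd : 1 < Module.finrank ℝ E)
    (hU : IsOpen U) (hc : Convex ℝ U)
    (hs : ∀ a ∈ closure U, ∀ b ∈ closure U, a ≠ b → openSegment ℝ a b ⊆ U) {z : E}
    (hz : z ∈ frontier U) {r : ℝ} (hr : 0 < r) :
    ∃ r' > 0, ∀ x ∈ U, dist x z < r' → ∃ a ∈ frontier U, ∃ b ∈ frontier U, dist a z < r ∧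
      dist b z < r ∧ a ≠ b ∧ x ∈ openSegment ℝ a b := by
  have hz' : z ∈ closure U := frontier_subset_closure hz
  have hzU : z ∉ U := (hU.frontier_eq ▸ hz).2
  obtain ⟨φ, hφ⟩ := geometric_hahn_banach_open_point hc hU hzU
  have hφ' : ∀ w ∈ closure U, w ≠ z → φ w < φ z := by
    intro w hw hwz
    have h1 := hφ _ (hs w hw z hz' hwz (midpoint_mem_openSegment w z))
    rw [midpoint_eq_smul_add, map_smul, map_add, smul_eq_mul] at h1
    simp only [invOf_eq_inv] at h1
    linarith
  obtain ⟨m, hm, hmax⟩ : ∃ m < φ z, ∀ w ∈ closure U ∩ sphere z (r / 2), φ w ≤ m := by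
    have hcomp : IsCompact (closure U ∩ sphere z (r / 2)) := by
      have := FiniteDimensional.proper ℝ E
      exact (isCompact_sphere z (r / 2)).inter_left isClosed_closure
    rcases (closure U ∩ sphere z (r / 2)).eq_empty_or_nonempty with he | hne
    · exact ⟨φ z - 1, by linarith, by simp [he]⟩
    · obtain ⟨w, hw, hwm⟩ := hcomp.exists_isMaxOn hne φ.continuous.continuousOn
      refine ⟨φ w, hφ' w hw.1 ?_, fun u hu => hwm hu⟩
      rintro rfl
      have := hw.2
      rw [mem_sphere, dist_self] at this
      linarith
  have hsmall : ∀ w ∈ closure U, m < φ w → dist w z < r := by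
    intro w hw hmw
    by_contra! hrw
    have hpos : 0 < dist w z := hr.trans_le hrw
    set θ : ℝ := r / 2 / dist w z with hθ
    have hθ0 : 0 ≤ θ := by positivity
    have hθ1 : θ ≤ 1 := by rw [hθ, div_le_one hpos]; linarith
    have hmem : AffineMap.lineMap z w θ ∈ closure U :=
      hc.closure.segment_subset hz' hw (by
        rw [segment_eq_image_lineMap]
        exact ⟨θ, ⟨hθ0, hθ1⟩, rfl⟩)
    have h1 := hmax _ ⟨hmem, by
      rw [mem_sphere, dist_lineMap_left, Real.norm_of_nonneg hθ0, dist_comm z w, hθ,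
        div_mul_cancel₀ _ hpos.ne']⟩
    rw [AffineMap.lineMap_apply_module, map_add, map_smul, map_smul, smul_eq_mul,
      smul_eq_mul] at h1
    have hθ2 : 0 < θ := by positivity
    linarith [mul_pos hθ2 (sub_pos.2 hmw), mul_nonneg (sub_nonneg.2 hθ1) (sub_pos.2 hm).le]
  obtain ⟨r', hr', hball⟩ := Metric.isOpen_iff.1 (isOpen_lt continuous_const φ.continuous) z hm
  obtain ⟨e, he, he0⟩ : ∃ e, φ e = 0 ∧ e ≠ 0 := by
    have := LinearMap.ker_ne_bot_of_finrank_lt (f := φ.toLinearMap) (by simpa using hd)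
    obtain ⟨e, he, he0⟩ := (Submodule.ne_bot_iff _).1 this
    exact ⟨e, he, he0⟩
  have hexit : ∀ x ∈ U, dist x z < r' → ∀ e, φ e = 0 → e ≠ 0 →
      ∃ t : ℝ, 0 < t ∧ x + t • e ∈ frontier U ∧ dist (x + t • e) z < r := by
    intro x hx hxz e he he0
    have hpos : 0 < ‖e‖ := norm_pos_iff.2 he0
    have hxm : ∀ t : ℝ, m < φ (x + t • e) := by
      intro t
      rw [map_add, map_smul, he, smul_zero, add_zero]
      exact hball hxz
    obtain ⟨t, ht, htf⟩ := exists_pos_add_smul_mem_frontier (e := e) hU hx (by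
      refine ⟨(r + dist x z) / ‖e‖, by positivity, fun hmem => ?_⟩
      have h1 := hsmall _ (subset_closure hmem) (hxm _)
      have h2 := dist_triangle_right (x + ((r + dist x z) / ‖e‖) • e) x z
      rw [dist_self_add_left, norm_smul, Real.norm_of_nonneg (by positivity),
        div_mul_cancel₀ _ hpos.ne'] at h2
      linarith)
    exact ⟨t, ht, htf, hsmall _ (frontier_subset_closure htf) (hxm t)⟩
  refine ⟨r', hr', fun x hx hxz => ?_⟩
  obtain ⟨t, ht, h1, h2⟩ := hexit x hx hxz e he he0
  obtain ⟨s, hs, h3, h4⟩ := hexit x hx hxz (-e) (by simp [he]) (by simpa)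
  refine ⟨_, h1, _, h3, h2, h4, fun h => ?_, s / (s + t), t / (s + t), by positivity,
    by positivity, by field_simp, ?_⟩
  · rw [_root_.add_right_inj, smul_neg, ← sub_eq_zero, sub_neg_eq_add, ← add_smul] at h
    exact (smul_eq_zero.1 h).elim (by positivity) he0
  · have h5 : s / (s + t) + t / (s + t) = 1 := by field_simp
    have h6 : s / (s + t) * t = t / (s + t) * s := by ring
    calc (s / (s + t)) • (x + t • e) + (t / (s + t)) • (x + s • -e)
        = (s / (s + t) + t / (s + t)) • x + (s / (s + t) * t - t / (s + t) * s) • e := by module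
      _ = x := by rw [h5, h6]; simp

/-- The frontier of a strictly convex open set is connected. -/
theorem isPreconnected_frontier_of_openSegment_subset [FiniteDimensional ℝ E]
    (hd : 1 < Module.finrank ℝ E) (hU : IsOpen U) (hc : Convex ℝ U)
    (hs : ∀ a ∈ closure U, ∀ b ∈ closure U, a ≠ b → openSegment ℝ a b ⊆ U) :
    IsPreconnected (frontier U) := by
  refine isPreconnected_of_forall_pair fun a ha b hb => ?_
  rcases eq_or_ne a b with rfl | hab
  · exact ⟨{a}, by simpa, by simp, by simp, isPreconnected_singleton⟩
  have hmU : midpoint ℝ a b ∈ U := hs a (frontier_subset_closure ha) b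
    (frontier_subset_closure hb) hab (midpoint_mem_openSegment a b)
  set m := midpoint ℝ a b with hm
  set v := a - m with hv
  have hv0 : v ≠ 0 := by
    intro h
    have h1 : a = midpoint ℝ a b := sub_eq_zero.1 h
    exact hab ((midpoint_eq_left_iff (R := ℝ)).1 h1.symm)
  have hma : m + v = a := by simp [hv]
  have hmb : m + -v = b := by
    have : m + m = a + b := midpoint_add_self ℝ a b
    rw [hv, neg_sub, ← add_sub_assoc, this, add_sub_cancel_left]
  let W : Set E := (fun w => m + w) ⁻¹' U
  have hWo : IsOpen W := hU.preimage (by fun_prop)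
  have hWc : Convex ℝ W := hc.translate_preimage_right m
  have h0W : (0 : E) ∈ W := by simpa [W] using hmU
  have hW0 : W ∈ 𝓝 0 := hWo.mem_nhds h0W
  have hfr : ∀ w, gauge W w = 1 ↔ m + w ∈ frontier U := by
    intro w
    rw [gauge_eq_one_iff_mem_frontier hWc hW0]
    exact Iff.symm (Set.ext_iff.1 ((Homeomorph.addLeft m).preimage_frontier U) w)
  have hcl : ∀ w, gauge W w ≤ 1 ↔ m + w ∈ closure U := by
    intro w
    rw [gauge_le_one_iff_mem_closure hWc hW0]
    exact Iff.symm (Set.ext_iff.1 ((Homeomorph.addLeft m).preimage_closure U) w)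
  have hGc : Continuous (gauge W) := continuous_gauge hWc hW0
  have habs : Absorbent ℝ W := absorbent_nhds_zero hW0
  have hGadd : ∀ x y, gauge W (x + y) ≤ gauge W x + gauge W y := gauge_add_le hWc habs
  have hGsmul : ∀ (t : ℝ) x, 0 ≤ t → gauge W (t • x) = t * gauge W x := fun t x ht => by
    rw [gauge_smul_of_nonneg ht, smul_eq_mul]
  have hGv : gauge W v = 1 := (hfr v).2 (hma ▸ ha)
  have hGv' : gauge W (-v) = 1 := (hfr (-v)).2 (hmb ▸ hb)
  have hGsv : ∀ t : ℝ, gauge W (t • v) = |t| := by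
    intro t
    rcases le_total 0 t with h | h
    · rw [hGsmul t v h, hGv, mul_one, abs_of_nonneg h]
    · rw [← neg_smul_neg, hGsmul _ _ (by linarith), hGv', mul_one, abs_of_nonpos h]
  have hline : ∀ θ, θ ≠ 0 → gauge W θ = 0 → gauge W (-θ) ≠ 0 := by
    intro θ hθ h1 h2
    have h3 := (hcl (v + θ)).1 (by linarith [hGadd v θ])
    have h4 := (hcl (v + -θ)).1 (by linarith [hGadd v (-θ)])
    have h5 := hs _ h3 _ h4 (by
      rw [Ne, _root_.add_right_inj, _root_.add_right_inj]
      intro h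
      have h' : (2 : ℝ) • θ = 0 := by rw [two_smul]; exact add_eq_zero_iff_eq_neg.2 h
      exact hθ ((smul_eq_zero.1 h').resolve_left two_ne_zero)) (midpoint_mem_openSegment _ _)
    have h6 : midpoint ℝ (m + (v + θ)) (m + (v + -θ)) = a := by
      rw [← hma, midpoint_eq_smul_add, invOf_eq_inv]
      module
    rw [h6] at h5
    exact (hU.frontier_eq ▸ ha).2 h5
  obtain ⟨e, he⟩ : ∃ e, e ∉ ℝ ∙ v := by
    by_contra! h
    have := finrank_le_one v fun w => Submodule.mem_span_singleton.1 (h w)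
    omega
  have hθ0 : ∀ s c : ℝ, 0 < c → s • v + c • e ≠ 0 := by
    intro s c hc h
    refine he (Submodule.mem_span_singleton.2 ⟨-(s / c), ?_⟩)
    have h1 : c⁻¹ • (s • v + c • e) = 0 := by rw [h, smul_zero]
    rw [smul_add, smul_smul, smul_smul, inv_mul_cancel₀ hc.ne', one_smul] at h1
    rw [neg_smul, div_eq_inv_mul]
    exact neg_eq_of_add_eq_zero_right h1
  have hside : ∃ e', ∀ s ∈ Icc (-1 : ℝ) 1, gauge W (s • v + (1 - |s|) • e') ≠ 0 := by
    by_contra! hcon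
    obtain ⟨s, hs, h1⟩ := hcon e
    obtain ⟨t, ht, h2⟩ := hcon (-e)
    have hpos : ∀ (s : ℝ) e', s ∈ Icc (-1 : ℝ) 1 → gauge W (s • v + (1 - |s|) • e') = 0 →
        0 < 1 - |s| := by
      intro s e' hs h
      refine lt_of_le_of_ne (sub_nonneg.2 (abs_le.2 hs)) fun h' => ?_
      rw [← h', zero_smul, add_zero, hGsv] at h
      linarith
    have hc1 := hpos s e hs h1
    have hc2 := hpos t (-e) ht h2
    set c := 1 - |s|
    set d := 1 - |t|
    have h3 := hGadd (d • (s • v + c • e)) (c • (t • v + d • -e))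
    rw [hGsmul _ _ hc2.le, hGsmul _ _ hc1.le, h1, h2, mul_zero, mul_zero, add_zero] at h3
    have h4 : d • (s • v + c • e) + c • (t • v + d • -e) = (d * s + c * t) • v := by module
    rw [h4, hGsv] at h3
    have h5 : d * s + c * t = 0 := abs_eq_zero.1 (h3.antisymm (abs_nonneg _))
    refine hline _ (smul_ne_zero hc2.ne' (hθ0 s c hc1)) (by rw [hGsmul _ _ hc2.le, h1, mul_zero]) ?_
    have h6 : -(d • (s • v + c • e)) = c • (t • v + d • -e) := by
      rw [neg_eq_iff_add_eq_zero, h4, h5, zero_smul]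
    rw [h6, hGsmul _ _ hc1.le, h2, mul_zero]
  obtain ⟨e', he'⟩ := hside
  set h : ℝ → E := fun s => s • v + (1 - |s|) • e' with hh
  refine ⟨(fun s => m + (gauge W (h s))⁻¹ • h s) '' Icc (-1) 1, ?_, ⟨1, by simp, ?_⟩,
    ⟨-1, by simp, ?_⟩, isPreconnected_Icc.image _ ?_⟩
  · rintro _ ⟨s, hs, rfl⟩
    refine (hfr _).1 ?_
    rw [hGsmul _ _ (inv_nonneg.2 (gauge_nonneg _)), inv_mul_cancel₀ (he' s hs)]
  · simp [hh, hGv, hma]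
  · simp [hh, hGv', hmb]
  · have hhc : Continuous h := by fun_prop
    exact continuousOn_const.add (((hGc.comp hhc).continuousOn.inv₀ he').smul hhc.continuousOn)

end StrictlyConvex

/-- A distance preserving map on a subset of a Euclidean space extends to an isometry. -/
theorem exists_isometryEquiv_eqOn {E : Type*} [NormedAddCommGroup E] [InnerProductSpace ℝ E]
    [FiniteDimensional ℝ E] {S : Set E} {h : E → E}
    (hh : ∀ a ∈ S, ∀ b ∈ S, dist (h a) (h b) = dist a b) : ∃ J : E ≃ᵢ E, EqOn J h S := by
  rcases S.eq_empty_or_nonempty with rfl | ⟨o, ho⟩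
  · exact ⟨IsometryEquiv.refl E, by simp⟩
  let v : S → E := fun a => a.1 - o
  let w : S → E := fun a => h a.1 - h o
  have hin : ∀ a b, inner ℝ (w a) (w b) = inner ℝ (v a) (v b) := by
    intro a b
    rw [real_inner_eq_norm_mul_self_add_norm_mul_self_sub_norm_sub_mul_self_div_two,
      real_inner_eq_norm_mul_self_add_norm_mul_self_sub_norm_sub_mul_self_div_two]
    simp only [v, w, sub_sub_sub_cancel_right]
    simp only [← dist_eq_norm]
    rw [hh _ a.2 _ ho, hh _ b.2 _ ho, hh _ a.2 _ b.2]
  have hnorm : ∀ c, ‖Finsupp.linearCombination ℝ w c‖ = ‖Finsupp.linearCombination ℝ v c‖ := by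
    intro c
    refine (sq_eq_sq₀ (norm_nonneg _) (norm_nonneg _)).1 ?_
    simp only [← real_inner_self_eq_norm_sq, Finsupp.linearCombination_apply, Finsupp.sum,
      sum_inner, inner_sum, inner_smul_left, inner_smul_right, hin]
  obtain ⟨r, hr⟩ := (Finsupp.linearCombination ℝ v).rangeRestrict.exists_rightInverse_of_surjective
    (LinearMap.range_rangeRestrict _)
  have hr' : ∀ x, Finsupp.linearCombination ℝ v (r x) = x := fun x =>
    congrArg Subtype.val (LinearMap.congr_fun hr x)
  let L : LinearMap.range (Finsupp.linearCombination ℝ v) →ₗᵢ[ℝ] E :=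
    { toLinearMap := (Finsupp.linearCombination ℝ w) ∘ₗ r
      norm_map' := fun x => by
        rw [LinearMap.comp_apply, hnorm, hr']
        rfl }
  have hL : ∀ a : S, L.extend (v a) = w a := by
    intro a
    have hmem : Finsupp.linearCombination ℝ v (Finsupp.single a 1) = v a := by simp
    let x : LinearMap.range (Finsupp.linearCombination ℝ v) := ⟨v a, ⟨_, hmem⟩⟩
    have h1 : L.extend (v a) = L x := L.extend_apply x
    rw [h1, ← sub_eq_zero, ← norm_eq_zero]
    have h2 : L x - w a = Finsupp.linearCombination ℝ w (r x - Finsupp.single a 1) := by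
      rw [map_sub]
      simp [L]
    rw [h2, hnorm, map_sub, hr', hmem, sub_self, norm_zero]
  refine ⟨(IsometryEquiv.subRight o).trans ((L.extend.toLinearIsometryEquiv rfl).toIsometryEquiv.trans
    (IsometryEquiv.addRight (h o))), fun a ha => ?_⟩
  have := hL ⟨a, ha⟩
  simp only [v, w] at this
  simp [this]

section Paths

variable {E : Type*} [NormedAddCommGroup E] [NormedSpace ℝ E] [StrictConvexSpace ℝ E]

/-- A nonexpanding path which is locally isometric on an open interval is affine. -/
theorem exists_eq_add_smul_of_locally_isometric {Γ : ℝ → E} {L : ℝ} (hL : 0 < L)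
    (hlip : ∀ s ∈ Icc 0 L, ∀ t ∈ Icc 0 L, dist (Γ s) (Γ t) ≤ |s - t|)
    (hloc : ∀ t ∈ Ioo 0 L, ∃ δ > 0, ∀ s ∈ Icc 0 L, ∀ s' ∈ Icc 0 L, |s - t| < δ → |s' - t| < δ →
      dist (Γ s) (Γ s') = |s - s'|) :
    ∃ c w, ‖w‖ = 1 ∧ ∀ s ∈ Icc 0 L, Γ s = c + s • w := by
  have haff : ∀ t ∈ Ioo 0 L, ∃ c w, ‖w‖ = 1 ∧ Γ =ᶠ[𝓝 t] fun s => c + s • w := by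
    intro t ht
    obtain ⟨δ, hδ, h⟩ := hloc t ht
    obtain ⟨η, hη, hη1, hη2, hη3⟩ : ∃ η > 0, η < δ ∧ η < t ∧ η < L - t := by
      refine ⟨min (δ / 2) (min (t / 2) ((L - t) / 2)), ?_, ?_, ?_, ?_⟩
      · exact lt_min (by linarith) (lt_min (by linarith [ht.1]) (by linarith [ht.2]))
      · linarith [min_le_left (δ / 2) (min (t / 2) ((L - t) / 2))]
      · linarith [ht.1, min_le_right (δ / 2) (min (t / 2) ((L - t) / 2)),
          min_le_left (t / 2) ((L - t) / 2)]
      · linarith [ht.2, min_le_right (δ / 2) (min (t / 2) ((L - t) / 2)),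
          min_le_right (t / 2) ((L - t) / 2)]
    have hd : ∀ s ∈ Icc (t - η) (t + η), ∀ s' ∈ Icc (t - η) (t + η),
        dist (Γ s) (Γ s') = |s - s'| := by
      intro s hs s' hs'
      refine h s ⟨by linarith [hs.1], by linarith [hs.2]⟩ s' ⟨by linarith [hs'.1],
        by linarith [hs'.2]⟩ (abs_lt.2 ⟨?_, ?_⟩) (abs_lt.2 ⟨?_, ?_⟩)
      all_goals linarith [hs.1, hs.2, hs'.1, hs'.2]
    have hl : t - η ∈ Icc (t - η) (t + η) := ⟨le_rfl, by linarith⟩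
    have hr : t + η ∈ Icc (t - η) (t + η) := ⟨by linarith, le_rfl⟩
    have hlr : dist (Γ (t - η)) (Γ (t + η)) = 2 * η := by
      rw [hd _ hl _ hr, abs_of_nonpos (by linarith)]
      ring
    refine ⟨Γ (t - η) - ((t - η) / (2 * η)) • (Γ (t + η) - Γ (t - η)),
      (2 * η)⁻¹ • (Γ (t + η) - Γ (t - η)), ?_, ?_⟩
    · rw [norm_smul, ← dist_eq_norm, dist_comm, hlr, norm_inv, Real.norm_of_nonneg (by linarith),
        inv_mul_cancel₀ (by linarith)]
    · filter_upwards [Icc_mem_nhds (show t - η < t by linarith) (show t < t + η by linarith)]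
        with s hs
      have e : Γ s = AffineMap.lineMap (Γ (t - η)) (Γ (t + η)) ((s - (t - η)) / (2 * η)) := by
        refine eq_lineMap_of_dist_eq_mul_of_dist_eq_mul ?_ ?_
        · rw [hd _ hl _ hs, hlr, div_mul_cancel₀ _ (by linarith), abs_of_nonpos (by linarith [hs.1])]
          ring
        · rw [hd _ hs _ hr, hlr, sub_mul, div_mul_cancel₀ _ (by linarith),
            abs_of_nonpos (by linarith [hs.2])]
          ring
      rw [e, AffineMap.lineMap_apply_module', sub_div, div_eq_inv_mul s]
      module
  have hderiv : ∀ t ∈ Ioo 0 L, DifferentiableAt ℝ Γ t ∧ ‖deriv Γ t‖ = 1 ∧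
      deriv Γ =ᶠ[𝓝 t] fun _ => deriv Γ t := by
    intro t ht
    obtain ⟨c, w, hw, h⟩ := haff t ht
    have h1 : ∀ s, HasDerivAt (fun s : ℝ => c + s • w) w s := fun s => by
      simpa using ((hasDerivAt_id s).smul_const w).const_add c
    have h2 : deriv Γ =ᶠ[𝓝 t] fun _ => w :=
      h.deriv.trans (.of_forall fun s => (h1 s).deriv)
    have h3 : deriv Γ t = w := h2.eq_of_nhds
    exact ⟨((h1 t).congr_of_eventuallyEq h).differentiableAt, by rw [h3, hw], by rwa [h3]⟩
  have hhalf : L / 2 ∈ Ioo 0 L := ⟨by linarith, by linarith⟩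
  obtain ⟨w, hw⟩ := isOpen_Ioo.exists_is_const_of_deriv_eq_zero (f := deriv Γ) isPreconnected_Ioo
    (fun t ht => ((differentiableAt_const (deriv Γ t)).congr_of_eventuallyEq
      (hderiv t ht).2.2).differentiableWithinAt)
    (fun t ht => by rw [(hderiv t ht).2.2.deriv_eq]; simp)
  have hsub : ∀ t ∈ Ioo 0 L, HasDerivAt (fun s => Γ s - s • w) 0 t := by
    intro t ht
    have h1 : HasDerivAt (fun s => Γ s - s • w) (deriv Γ t - (1 : ℝ) • w) t :=
      (hderiv t ht).1.hasDerivAt.sub ((hasDerivAt_id t).smul_const w)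
    simpa [hw t ht] using h1
  obtain ⟨c, hc⟩ := isOpen_Ioo.exists_is_const_of_deriv_eq_zero (f := fun s => Γ s - s • w)
    isPreconnected_Ioo (fun t ht => (hsub t ht).differentiableAt.differentiableWithinAt)
    (fun t ht => (hsub t ht).deriv)
  refine ⟨c, w, by rw [← hw _ hhalf, (hderiv _ hhalf).2.1], ?_⟩
  have hcont : ContinuousOn Γ (Icc 0 L) :=
    (LipschitzOnWith.of_dist_le_mul (K := 1) fun s hs t ht => by
      simpa [Real.dist_eq] using hlip s hs t ht).continuousOn
  have heq : EqOn Γ (fun s => c + s • w) (Ioo 0 L) := fun s hs => by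
    have h1 : Γ s - s • w = c := hc s hs
    change Γ s = c + s • w
    rw [← h1, sub_add_cancel]
  exact heq.of_subset_closure hcont (by fun_prop) Ioo_subset_Icc_self
    (by rw [closure_Ioo hL.ne])

/-- A sequence of nonexpanding paths which are asymptotically locally isometric accumulates at a
segment. -/
theorem dist_eq_of_asymptotically_isometric [ProperSpace E] {γ : ℕ → ℝ → E} {L : ℝ} (hL : 0 < L)
    {A B : E} {e : ℕ → ℝ} (he : Tendsto e atTop (𝓝 0))
    (hlip : ∀ k, ∀ s ∈ Icc 0 L, ∀ t ∈ Icc 0 L, dist (γ k s) (γ k t) ≤ |s - t|)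
    (hA : Tendsto (fun k => γ k 0) atTop (𝓝 A)) (hB : Tendsto (fun k => γ k L) atTop (𝓝 B))
    (hloc : ∀ t ∈ Ioo 0 L, ∃ δ > 0, ∀ᶠ k in atTop, ∀ s ∈ Icc 0 L, ∀ s' ∈ Icc 0 L, |s - t| < δ →
      |s' - t| < δ → |s - s'| - e k ≤ dist (γ k s) (γ k s')) :
    dist A B = L ∧ ∀ η > 0, ∃ᶠ k in atTop, dist (γ k (L / 2)) (midpoint ℝ A B) < η := by
  have h0 : (0 : ℝ) ∈ Icc 0 L := ⟨le_rfl, hL.le⟩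
  have hLL : L ∈ Icc 0 L := ⟨hL.le, le_rfl⟩
  set F : Ultrafilter ℕ := hyperfilter ℕ
  have hF : (F : Filter ℕ) ≤ atTop := Nat.hyperfilter_le_atTop
  have hbdd : ∀ s ∈ Icc 0 L, ∃ q, Tendsto (fun k => γ k s) F (𝓝 q) := by
    intro s hs
    have hmem : ∀ᶠ k in (F : Filter ℕ), γ k s ∈ closedBall A (L + 1) := by
      filter_upwards [hF (hA.eventually (ball_mem_nhds A one_pos))] with k hk
      have h1 := hlip k s hs 0 h0
      rw [sub_zero, abs_of_nonneg hs.1] at h1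
      have h2 := dist_triangle (γ k s) (γ k 0) A
      rw [mem_closedBall]
      linarith [hs.2]
    obtain ⟨q, -, hq⟩ := (isCompact_closedBall A (L + 1)).ultrafilter_le_nhds'
      (F.map fun k => γ k s) hmem
    exact ⟨q, hq⟩
  have : Nonempty E := ⟨A⟩
  choose! Γ hΓ using hbdd
  have hΓd : ∀ s ∈ Icc 0 L, ∀ t ∈ Icc 0 L,
      Tendsto (fun k => dist (γ k s) (γ k t)) F (𝓝 (dist (Γ s) (Γ t))) :=
    fun s hs t ht => (hΓ s hs).dist (hΓ t ht)
  have hΓlip : ∀ s ∈ Icc 0 L, ∀ t ∈ Icc 0 L, dist (Γ s) (Γ t) ≤ |s - t| :=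
    fun s hs t ht => le_of_tendsto (hΓd s hs t ht) (.of_forall fun k => hlip k s hs t ht)
  obtain ⟨c, w, hw, hcw⟩ := exists_eq_add_smul_of_locally_isometric hL hΓlip (by
    intro t ht
    obtain ⟨δ, hδ, h⟩ := hloc t ht
    refine ⟨δ, hδ, fun s hs s' hs' h1 h2 => (hΓlip s hs s' hs').antisymm ?_⟩
    have h3 : Tendsto (fun k => |s - s'| - e k) F (𝓝 (|s - s'| - 0)) :=
      tendsto_const_nhds.sub (he.mono_left hF)
    rw [sub_zero] at h3
    refine le_of_tendsto_of_tendsto h3 (hΓd s hs s' hs') ?_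
    filter_upwards [hF h] with k hk
    exact hk s hs s' hs' h1 h2)
  have eA : A = c := by
    rw [← tendsto_nhds_unique (hΓ 0 h0) (hA.mono_left hF), hcw 0 h0, zero_smul, add_zero]
  have eB : B = c + L • w := by
    rw [← tendsto_nhds_unique (hΓ L hLL) (hB.mono_left hF), hcw L hLL]
  have hhalf : L / 2 ∈ Icc 0 L := ⟨by linarith, by linarith⟩
  have hmid : midpoint ℝ A B = Γ (L / 2) := by
    rw [hcw _ hhalf, eA, eB, midpoint_eq_smul_add, invOf_eq_inv]
    module
  refine ⟨?_, fun η hη => ?_⟩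
  · rw [eA, eB, dist_self_add_right, norm_smul, hw, mul_one, Real.norm_of_nonneg hL.le]
  · rw [hmid]
    have h1 : ∀ᶠ k in (F : Filter ℕ), dist (γ k (L / 2)) (Γ (L / 2)) < η :=
      (hΓ _ hhalf).eventually (ball_mem_nhds _ hη)
    exact h1.frequently.filter_mono hF

end Paths

section Chord

variable {E X : Type*} [NormedAddCommGroup E] [InnerProductSpace ℝ E] [MetricSpace X]
  {U V : Set E} {ι : E → X} {p : X → E} {g : E → X}

theorem dist_lineMap_sq (w a b : E) (θ : ℝ) :
    dist w (AffineMap.lineMap a b θ) ^ 2 =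
      (1 - θ) * dist w a ^ 2 + θ * dist w b ^ 2 - θ * (1 - θ) * dist a b ^ 2 := by
  have e1 : w - AffineMap.lineMap a b θ = (1 - θ) • (w - a) + θ • (w - b) := by
    rw [AffineMap.lineMap_apply_module]
    module
  have e2 : a - b = (w - b) - (w - a) := by abel
  rw [dist_eq_norm, dist_eq_norm, dist_eq_norm, dist_eq_norm, e1, e2, norm_add_sq_real,
    norm_sub_sq_real (w - b) (w - a), norm_smul, norm_smul, mul_pow, mul_pow, Real.norm_eq_abs, Real.norm_eq_abs,
    sq_abs, sq_abs, real_inner_smul_left, real_inner_smul_right, real_inner_comm (w - b) (w - a)]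
  ring

/-- Points outside of an open set containing an open segment are not almost on the segment. -/
theorem exists_pos_not_dist_le_of_openSegment_subset (hU : IsOpen U) {a b : E}
    (hab : openSegment ℝ a b ⊆ U) {t : ℝ} (ht : t ∈ Ioo 0 (dist a b)) :
    ∃ κ > 0, ∀ w ∉ U, ¬(dist w a ≤ t + κ ∧ dist w b ≤ dist a b - t + κ) := by
  have hL : 0 < dist a b := ht.1.trans ht.2
  set L := dist a b with hLdef
  set θ := t / L with hθ
  have htL : t = θ * L := by rw [hθ, div_mul_cancel₀ _ hL.ne']
  have hθ0 : 0 < θ := div_pos ht.1 hL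
  have hθ1 : θ < 1 := (div_lt_one hL).2 ht.2
  have hx : AffineMap.lineMap a b θ ∈ U := hab (by
    rw [openSegment_eq_image_lineMap]
    exact ⟨θ, ⟨hθ0, hθ1⟩, rfl⟩)
  obtain ⟨η, hη, hηU⟩ := Metric.isOpen_iff.1 hU _ hx
  obtain ⟨κ, hκ, hκη⟩ : ∃ κ > 0, L * κ + κ ^ 2 < η ^ 2 := by
    have h1 : Tendsto (fun κ => L * κ + κ ^ 2) (𝓝 0) (𝓝 (L * 0 + 0 ^ 2)) :=
      Continuous.tendsto (by fun_prop) 0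
    have h2 : ∀ᶠ κ in 𝓝[>] (0 : ℝ), L * κ + κ ^ 2 < η ^ 2 :=
      nhdsWithin_le_nhds (h1.eventually (gt_mem_nhds (by simp; positivity)))
    obtain ⟨κ, h3, h4⟩ := (h2.and self_mem_nhdsWithin).exists
    exact ⟨κ, h4, h3⟩
  refine ⟨κ, hκ, fun w hw ⟨h1, h2⟩ => hw (hηU ?_)⟩
  rw [mem_ball, ← abs_of_nonneg (dist_nonneg (x := w)), ← abs_of_pos hη, ← sq_lt_sq,
    dist_lineMap_sq]
  have h3 : dist w a ^ 2 ≤ (t + κ) ^ 2 := by gcongr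
  have h4 : dist w b ^ 2 ≤ (L - t + κ) ^ 2 := by gcongr
  have h5 := mul_le_mul_of_nonneg_left h3 (sub_pos.2 hθ1).le
  have h6 := mul_le_mul_of_nonneg_left h4 hθ0.le
  rw [htL] at h5 h6
  rw [← hLdef]
  have h7 : 4 * (θ * (1 - θ)) ≤ 1 := by nlinarith [sq_nonneg (2 * θ - 1)]
  have h8 := mul_le_mul_of_nonneg_right h7 (mul_pos hL hκ).le
  nlinarith

/-- If irregular boundary points near the chord `[a, b]` keep their distance to `a` and `b`, then
the map `g` preserves the Euclidean length of the chord. -/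
theorem LocalBoundaryIsometry.dist_proj_eq [FiniteDimensional ℝ E] [CompleteSpace X]
    (H : LocalBoundaryIsometry U V ι p g) {a b : E} (ha : a ∈ frontier U) (hb : b ∈ frontier U)
    (hab : a ≠ b) (h1 : dist (g a) (g b) = dist a b)
    (h2 : ∀ w ∈ frontier U, (¬∃ r J, RegularWith U V ι g w r J) →
      dist (g w) (g a) ≤ 2 * dist a b →
      dist (g w) (g a) = dist w a ∧ dist (g w) (g b) = dist w b) :
    dist (p (g a)) (p (g b)) = dist a b ∧ ∀ η > 0, ∃ v ∈ V,
      dist v (midpoint ℝ (p (g a)) (p (g b))) < η ∧ dist (ι v) (g a) ≤ 2 * dist a b := by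
  have : ProperSpace E := FiniteDimensional.proper ℝ E
  set L := dist a b with hLdef
  have hL : 0 < L := dist_pos.2 hab
  set ε : ℕ → ℝ := fun k => 1 / ((k : ℝ) + 1) with hε
  have hε0 : ∀ k, 0 < ε k := fun k => Nat.one_div_pos_of_nat
  have hεlim : Tendsto ε atTop (𝓝 0) := tendsto_one_div_add_atTop_nhds_zero_nat
  choose x hxV hx using fun k => H.model.dense (g a) (ε k) (hε0 k)
  choose x' hxV' hx' using fun k => H.model.dense (g b) (ε k) (hε0 k)
  have hpath : ∀ k, HasPath V (x k) (x' k) (L + 2 * ε k) := fun k => by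
    refine H.model.hasPath _ (hxV k) _ (hxV' k) _ ?_
    have := dist_triangle4_right (ι (x k)) (ι (x' k)) (g a) (g b)
    linarith [hx k, hx' k]
  choose hℓ γ hγ0 hγℓ hγV hγ using hpath
  have hsub : ∀ k, ∀ s ∈ Icc 0 L, s ∈ Icc 0 (L + 2 * ε k) := fun k s hs =>
    ⟨hs.1, by linarith [hs.2, hε0 k]⟩
  have hι : ∀ k, ∀ s ∈ Icc 0 (L + 2 * ε k), ∀ t ∈ Icc 0 (L + 2 * ε k), s ≤ t →
      dist (ι (γ k s)) (ι (γ k t)) ≤ t - s := fun k s hs t ht hst =>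
    H.model.dist_le _ _ _ (HasPath.restrict hst (fun τ hτ => hγV k τ ⟨hs.1.trans hτ.1,
      hτ.2.trans ht.2⟩) fun σ hσ τ hτ => hγ k σ ⟨hs.1.trans hσ.1, hσ.2.trans ht.2⟩ τ
      ⟨hs.1.trans hτ.1, hτ.2.trans ht.2⟩)
  have h0 : ∀ k, (0 : ℝ) ∈ Icc 0 (L + 2 * ε k) := fun k => ⟨le_rfl, hℓ k⟩
  have hend : ∀ k, L + 2 * ε k ∈ Icc 0 (L + 2 * ε k) := fun k => ⟨hℓ k, le_rfl⟩
  have hleft : ∀ k, ∀ s ∈ Icc 0 L, dist (ι (γ k s)) (g a) ≤ s + ε k := fun k s hs => by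
    have h3 := hι k 0 (h0 k) s (hsub k s hs) hs.1
    rw [hγ0, dist_comm] at h3
    linarith [dist_triangle (ι (γ k s)) (ι (x k)) (g a), hx k]
  have hright : ∀ k, ∀ s ∈ Icc 0 L, dist (ι (γ k s)) (g b) ≤ L - s + 3 * ε k :=
    fun k s hs => by
      have h3 := hι k s (hsub k s hs) _ (hend k) (hsub k s hs).2
      rw [hγℓ] at h3
      linarith [dist_triangle (ι (γ k s)) (ι (x' k)) (g b), hx' k]
  have hlow : ∀ k, ∀ s ∈ Icc 0 L, ∀ t ∈ Icc 0 L,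
      t - s - 4 * ε k ≤ dist (ι (γ k s)) (ι (γ k t)) := fun k s hs t ht => by
    have h3 := dist_triangle4 (g a) (ι (γ k s)) (ι (γ k t)) (g b)
    rw [dist_comm (g a) (ι (γ k s))] at h3
    linarith [hleft k s hs, hright k t ht]
  have hproj : ∀ k, ∀ t ∈ Icc 0 L, p (ι (γ k t)) = γ k t := fun k t ht =>
    H.model.proj_incl _ (hγV k t (hsub k t ht))
  have h0L : (0 : ℝ) ∈ Icc 0 L := ⟨le_rfl, hL.le⟩
  have hLL : L ∈ Icc 0 L := ⟨hL.le, le_rfl⟩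
  have hA : Tendsto (fun k => γ k 0) atTop (𝓝 (p (g a))) := by
    refine tendsto_iff_dist_tendsto_zero.2 (squeeze_zero (fun _ => dist_nonneg) (fun k => ?_) hεlim)
    have h3 := hleft k 0 h0L
    rw [zero_add] at h3
    have h4 := H.model.dist_proj_le (ι (γ k 0)) (g a)
    rw [hproj k 0 h0L] at h4
    exact h4.trans h3
  have hB : Tendsto (fun k => γ k L) atTop (𝓝 (p (g b))) := by
    refine tendsto_iff_dist_tendsto_zero.2 (squeeze_zero (fun _ => dist_nonneg) (fun k => ?_)
      (by simpa using hεlim.const_mul 3))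
    have h3 := hright k L hLL
    rw [sub_self, zero_add] at h3
    have h4 := H.model.dist_proj_le (ι (γ k L)) (g b)
    rw [hproj k L hLL] at h4
    exact h4.trans h3
  obtain ⟨h3, h4⟩ := dist_eq_of_asymptotically_isometric (e := fun k => 4 * ε k) hL
    (by simpa using hεlim.const_mul 4)
    (fun k s hs t ht => hγ k s (hsub k s hs) t (hsub k t ht)) hA hB (by
    intro t ht
    obtain ⟨κ₀, hκ₀, hgeo⟩ := exists_pos_not_dist_le_of_openSegment_subset H.isOpen_left
      (H.openSegment_subset a (frontier_subset_closure ha) b (frontier_subset_closure hb) hab) ht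
    obtain ⟨κ, hκ, hκκ₀, hκL⟩ : ∃ κ > 0, κ ≤ κ₀ ∧ κ ≤ L :=
      ⟨min κ₀ L, lt_min hκ₀ hL, min_le_left _ _, min_le_right _ _⟩
    refine ⟨κ / 4, by positivity, ?_⟩
    filter_upwards [hεlim.eventually (gt_mem_nhds (show (0 : ℝ) < κ / 12 by positivity))] with k hk
    have hord : ∀ s ∈ Icc 0 L, ∀ s' ∈ Icc 0 L, s ≤ s' → |s - t| < κ / 4 → |s' - t| < κ / 4 →
        s' - s - 4 * ε k ≤ dist (γ k s) (γ k s') := by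
      intro s hs s' hs' hss hst hst'
      rw [abs_lt] at hst hst'
      refine (hlow k s hs s' hs').trans (le_of_eq (H.model.dist_incl ?_))
      have hmem : ∀ τ ∈ Icc 0 (s' - s), s + τ ∈ Icc 0 (L + 2 * ε k) := fun τ hτ =>
        ⟨by linarith [hs.1, hτ.1], by linarith [hτ.2, (hsub k s' hs').2]⟩
      have h5 := H.segment_subset (γ := fun τ => γ k (s + τ)) (ℓ := s' - s) rfl
        (fun τ hτ => hγV k _ (hmem τ hτ))
        (fun σ hσ τ hτ => by simpa using hγ k _ (hmem σ hσ) _ (hmem τ hτ))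
        convex_univ (fun _ _ => mem_univ _) (by
          intro w hw hwd _
          by_contra hirr
          rw [add_zero] at hwd
          have e1 := dist_triangle_left (g w) (g a) (ι (γ k s))
          have e2 := dist_triangle_left (g w) (g b) (ι (γ k s))
          have e3 := hleft k s hs
          have e4 := hright k s hs
          have e5 := h2 w hw hirr (by linarith [ht.2])
          refine hgeo w (fun hwU => ?_) ⟨?_, ?_⟩
          · exact (H.isOpen_left.frontier_eq ▸ hw).2 hwU
          · linarith [e5.1]
          · linarith [e5.2]) (s := s' - s) ⟨by linarith, le_rfl⟩
      simpa using h5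
    intro s hs s' hs' hst hst'
    rcases le_total s s' with h | h
    · rw [abs_sub_comm, abs_of_nonneg (sub_nonneg.2 h)]
      exact hord s hs s' hs' h hst hst'
    · rw [abs_of_nonneg (sub_nonneg.2 h), dist_comm]
      exact hord s' hs' s hs h hst' hst)
  refine ⟨h3, fun η hη => ?_⟩
  have hhalf : L / 2 ∈ Icc 0 L := ⟨by linarith, by linarith⟩
  obtain ⟨k, hk, hk'⟩ := ((h4 η hη).and_eventually (hεlim.eventually (gt_mem_nhds hL))).exists
  exact ⟨_, hγV k _ (hsub k _ hhalf), hk, by linarith [hleft k _ hhalf]⟩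

end Chord

section BairePoint

/-- An injective continuous map with closed range in a complete space has a point of continuity
of its inverse. -/
theorem exists_forall_dist_lt_of_isClosed_image {E X : Type*} [PseudoMetricSpace E] [ProperSpace E]
    [T2Space E] [MetricSpace X] [CompleteSpace X] {S : Set E} {g : E → X} (hS : IsClosed S)
    (hne : S.Nonempty) (hg : ContinuousOn g S) (hi : InjOn g S) (hc : IsClosed (g '' S)) :
    ∃ y ∈ S, ∀ ε > 0, ∃ ρ > 0, ∀ w ∈ S, dist (g w) (g y) < ρ → dist w y < ε := by
  obtain ⟨x₀, hx₀⟩ := hne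
  have := hc.completeSpace_coe
  have : Nonempty (g '' S) := ⟨⟨g x₀, mem_image_of_mem g hx₀⟩⟩
  have hK : ∀ m : ℕ, IsCompact (S ∩ closedBall x₀ m) := fun m =>
    (isCompact_closedBall x₀ m).inter_left hS
  obtain ⟨m, ξ, hξ⟩ := nonempty_interior_of_iUnion_of_closed
    (f := fun m : ℕ => ((↑) : g '' S → X) ⁻¹' (g '' (S ∩ closedBall x₀ m)))
    (fun m => (((hK m).image_of_continuousOn (hg.mono inter_subset_left)).isClosed).preimage
      continuous_subtype_val) (by
      refine eq_univ_of_forall fun ξ => ?_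
      obtain ⟨_, y, hy, rfl⟩ := ξ
      obtain ⟨m, hm⟩ := exists_nat_ge (dist y x₀)
      exact mem_iUnion.2 ⟨m, y, ⟨hy, hm⟩, rfl⟩)
  obtain ⟨_, y, hy, rfl⟩ := ξ
  obtain ⟨ρ₀, hρ₀, hball⟩ := Metric.mem_nhds_iff.1 (mem_interior_iff_mem_nhds.1 hξ)
  have hmem : ∀ w ∈ S, dist (g w) (g y) < ρ₀ → w ∈ S ∩ closedBall x₀ m := by
    intro w hw hwd
    obtain ⟨w', hw', h⟩ : g w ∈ g '' (S ∩ closedBall x₀ m) :=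
      hball (a := ⟨g w, mem_image_of_mem g hw⟩) hwd
    rwa [← hi hw'.1 hw h]
  refine ⟨y, hy, fun ε hε => ?_⟩
  have hcomp : IsCompact ((S ∩ closedBall x₀ m) \ ball y ε) := (hK m).diff isOpen_ball
  have hclosed : IsClosed (g '' ((S ∩ closedBall x₀ m) \ ball y ε)) :=
    (hcomp.image_of_continuousOn (hg.mono fun w hw => hw.1.1)).isClosed
  have hy' : g y ∉ g '' ((S ∩ closedBall x₀ m) \ ball y ε) := by
    rintro ⟨w, hw, h⟩
    rw [hi hw.1.1 hy h] at hw
    exact hw.2 (mem_ball_self hε)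
  obtain ⟨ρ₁, hρ₁, hball₁⟩ := Metric.isOpen_iff.1 hclosed.isOpen_compl _ hy'
  refine ⟨min ρ₀ ρ₁, lt_min hρ₀ hρ₁, fun w hw hwd => ?_⟩
  by_contra h
  exact hball₁ (hwd.trans_le (min_le_right _ _))
    ⟨w, ⟨hmem w hw (hwd.trans_le (min_le_left _ _)), h⟩, rfl⟩

end BairePoint

namespace LocalBoundaryIsometry

variable {E X : Type*} [NormedAddCommGroup E] [NormedSpace ℝ E] [MetricSpace X] {U V : Set E}
  {ι : E → X} {p : X → E} {g : E → X}

theorem isClosed_irregular :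
    IsClosed {w | w ∈ frontier U ∧ ¬∃ r J, RegularWith U V ι g w r J} := by
  rw [← isOpen_compl_iff, Metric.isOpen_iff]
  intro w hw
  by_cases hwU : w ∈ frontier U
  · obtain ⟨r, J, h⟩ : ∃ r J, RegularWith U V ι g w r J := by
      by_contra hn
      exact hw ⟨hwU, hn⟩
    exact ⟨r, h.pos, fun z hz hz' => hz'.2 ⟨_, _, h.of_dist_lt hz⟩⟩
  · obtain ⟨ε, hε, h⟩ := Metric.isOpen_iff.1 isClosed_frontier.isOpen_compl w hwU
    exact ⟨ε, hε, fun z hz hz' => h hz hz'.1⟩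

theorem isClosed_image_irregular (H : LocalBoundaryIsometry U V ι p g) :
    IsClosed (g '' {w | w ∈ frontier U ∧ ¬∃ r J, RegularWith U V ι g w r J}) := by
  rw [← isOpen_compl_iff, Metric.isOpen_iff]
  intro ξ hξ
  by_cases hξV : p ξ ∈ V
  · obtain ⟨ε, hε, h⟩ := Metric.isOpen_iff.1
      (H.isOpen_right.preimage H.model.continuous_proj) ξ hξV
    refine ⟨ε, hε, ?_⟩
    rintro _ hη ⟨z, hz, rfl⟩
    exact H.proj_notMem z hz.1 (h hη)
  · obtain ⟨w, hw, rfl⟩ := H.exists_eq ξ hξV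
    obtain ⟨r, J, h⟩ : ∃ r J, RegularWith U V ι g w r J := by
      by_contra hn
      exact hξ ⟨w, ⟨hw, hn⟩, rfl⟩
    refine ⟨r, h.pos, ?_⟩
    rintro _ hη ⟨z, hz, rfl⟩
    obtain ⟨u, hu, huw, hgu⟩ := H.exists_eq_of_dist_lt h hw hη (H.proj_notMem z hz.1)
    rw [H.injOn hu hz.1 hgu] at huw
    exact hz.2 ⟨_, _, h.of_dist_lt huw⟩

end LocalBoundaryIsometry

theorem IsometryEquiv.convex_preimage {E F : Type*} [NormedAddCommGroup E] [NormedSpace ℝ E]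
    [NormedAddCommGroup F] [NormedSpace ℝ F] (J : E ≃ᵢ F) {s : Set F} (hs : Convex ℝ s) :
    Convex ℝ (J ⁻¹' s) :=
  hs.affine_preimage J.toRealAffineIsometryEquiv.toAffineEquiv.toAffineMap

namespace LocalBoundaryIsometry

variable {E X : Type*} [NormedAddCommGroup E] [NormedSpace ℝ E] [MetricSpace X] {U V : Set E}
  {ι : E → X} {p : X → E} {g : E → X} {y : E} {J : E ≃ᵢ E} {r s : ℝ}

/-- If `p ∘ g` agrees with `J` near `y`, the points of `V` intrinsically close to `g y` belong to
`J '' U` as soon as one of them does. -/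
theorem symm_mem_of_proj_eq (H : LocalBoundaryIsometry U V ι p g) (hy : y ∈ frontier U)
    (hr : 0 < r) (hJ : ∀ z ∈ frontier U, dist z y < r → p (g z) = J z)
    {v₀ v : E} (hv₀ : v₀ ∈ V) (hv₀U : J.symm v₀ ∈ U) (hv₀y : dist (ι v₀) (g y) < r / 3)
    (hv : v ∈ V) (hvy : dist (ι v) (g y) < r / 3) : J.symm v ∈ U := by
  have h1 := dist_triangle_right (ι v₀) (ι v) (g y)
  have h2 := H.model.hasPath v₀ hv₀ v hv (2 * r / 3) (by linarith)
  have h3 := h2.of_disjoint_frontier (W := J.symm ⁻¹' U)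
    (H.isOpen_left.preimage J.symm.continuous) hv₀U ?_
  · exact h3.right_mem.2
  · intro z hz hzd _ hzf
    rw [J.frontier_preimage_symm] at hzf
    have e := hJ y hy (by simpa using hr)
    have h4 : dist (J.symm z) y < r := by
      rw [← J.isometry.dist_eq, J.apply_symm_apply, ← e]
      have h5 := H.model.dist_proj_le (ι v₀) (g y)
      rw [H.model.proj_incl v₀ hv₀] at h5
      linarith [dist_triangle z v₀ (p (g y))]
    refine H.proj_notMem _ hzf ?_
    rwa [hJ _ hzf h4, J.apply_symm_apply]

/-- A boundary point `y` is regular if `p ∘ g` agrees with an isometry near `y` and segments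
joining points of `V` intrinsically close to `g y` are contained in `V`. -/
theorem regularWith_of_segment_subset [FiniteDimensional ℝ E] (hd : 1 < Module.finrank ℝ E)
    (H : LocalBoundaryIsometry U V ι p g) (hy : y ∈ frontier U) (hs : 0 < s)
    (hJ : ∀ z ∈ frontier U, dist z y < s → p (g z) = J z)
    (hg : ∀ z ∈ frontier U, dist z y < s → dist (g z) (g y) = dist z y)
    (hseg : ∀ v ∈ V, ∀ v' ∈ V, dist (ι v) (g y) < s → dist (ι v') (g y) < s →
      segment ℝ v v' ⊆ V) : ∃ r, RegularWith U V ι g y r J := by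
  have hdist : ∀ v ∈ V, dist (ι v) (g y) < s → ∀ z ∈ frontier U, dist z y < s →
      dist (ι v) (g z) = dist v (J z) := by
    intro v hv hvy z hz hzy
    refine le_antisymm ?_ ?_
    · refine le_of_forall_pos_le_add fun ε hε => ?_
      obtain ⟨v', hv', hd'⟩ := H.model.dense (g z) (min (ε / 2) (s - dist z y))
        (lt_min (by positivity) (by linarith))
      have h1 : dist (ι v') (g y) < s := by
        linarith [dist_triangle (ι v') (g z) (g y), hg z hz hzy,
          min_le_right (ε / 2) (s - dist z y)]
      have h2 := H.model.dist_incl (hseg v hv v' hv' hvy h1)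
      have h3 := H.model.dist_proj_le (ι v') (g z)
      rw [H.model.proj_incl v' hv', hJ z hz hzy] at h3
      linarith [dist_triangle (ι v) (ι v') (g z), dist_triangle_right v v' (J z),
        min_le_left (ε / 2) (s - dist z y)]
    · have h1 := H.model.dist_proj_le (ι v) (g z)
      rwa [H.model.proj_incl v hv, hJ z hz hzy] at h1
  have hyy : dist y y < s := by simpa using hs
  set N : Set E := {v | v ∈ V ∧ dist (ι v) (g y) < s / 3} with hN
  have hNo : IsOpen N := by
    refine Metric.isOpen_iff.2 fun v hv => ?_
    obtain ⟨ε, hε, hb⟩ := Metric.isOpen_iff.1 H.isOpen_right v hv.1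
    refine ⟨min ε (s / 3 - dist (ι v) (g y)), lt_min hε (by linarith [hv.2]), fun v' hv' => ?_⟩
    rw [mem_ball] at hv'
    have h1 : v' ∈ ball v ε := hv'.trans_le (min_le_left _ _)
    have h2 := H.model.dist_incl
      (((convex_ball v ε).segment_subset h1 (mem_ball_self hε)).trans hb)
    refine ⟨hb h1, ?_⟩
    linarith [dist_triangle (ι v') (ι v) (g y), min_le_right ε (s / 3 - dist (ι v) (g y))]
  have hNc : Convex ℝ N := by
    refine convex_iff_segment_subset.2 fun v hv v' hv' c hc => ?_
    have h1 : segment ℝ v v' ⊆ V :=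
      hseg v hv.1 v' hv'.1 (by linarith [hv.2]) (by linarith [hv'.2])
    have h2 : dist (ι v) (ι c) = dist v c := H.model.dist_incl
      (((convex_segment v v').segment_subset (left_mem_segment ℝ v v') hc).trans h1)
    have h3 := H.model.dist_incl h1
    have h4 : dist v c ≤ dist v v' := by
      linarith [dist_add_dist_of_mem_segment hc, dist_nonneg (x := c) (y := v')]
    have h5 : dist (ι c) (g y) < s := by
      linarith [dist_triangle_left (ι c) (g y) (ι v), dist_triangle_right (ι v) (ι v') (g y),
        hv.2, hv'.2]
    refine ⟨h1 hc, ?_⟩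
    rw [hdist c (h1 hc) h5 y hy hyy]
    refine (convex_ball (J y) (s / 3)).segment_subset ?_ ?_ hc
    · rw [mem_ball, ← hdist v hv.1 (by linarith [hv.2]) y hy hyy]
      exact hv.2
    · rw [mem_ball, ← hdist v' hv'.1 (by linarith [hv'.2]) y hy hyy]
      exact hv'.2
  have hNcl : ∀ z ∈ frontier U, dist z y < s / 3 → J z ∈ closure N := by
    intro z hz hzy
    refine Metric.mem_closure_iff.2 fun ε hε => ?_
    obtain ⟨v, hv, hvz⟩ := H.model.dense (g z) (min ε (s / 3 - dist z y))
      (lt_min hε (by linarith))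
    have hzs : dist z y < s := by linarith
    refine ⟨v, ⟨hv, ?_⟩, ?_⟩
    · linarith [dist_triangle (ι v) (g z) (g y), hg z hz hzs, min_le_right ε (s / 3 - dist z y)]
    · have h1 := H.model.dist_proj_le (ι v) (g z)
      rw [H.model.proj_incl v hv, hJ z hz hzs] at h1
      rw [dist_comm]
      exact h1.trans_lt (hvz.trans_le (min_le_left _ _))
  have hNint : interior (closure N) = N := by
    obtain ⟨v, hv, hvy⟩ := H.model.dense (g y) (s / 3) (by linarith)
    rw [hNc.interior_closure_eq_interior_of_nonempty_interior, hNo.interior_eq]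
    rw [hNo.interior_eq]
    exact ⟨v, hv, hvy⟩
  obtain ⟨r', hr', hcov⟩ := exists_forall_mem_openSegment hd H.isOpen_left H.convex
    H.openSegment_subset hy (r := s / 3) (by linarith)
  have hJN : ∀ x ∈ U, dist x y < r' → J x ∈ N := by
    have hsub : U ∩ ball y r' ⊆ J ⁻¹' closure N := by
      rintro x ⟨hx, hxy⟩
      obtain ⟨a, ha, b, hb, hay, hby, -, hxab⟩ := hcov x hx hxy
      exact (J.convex_preimage hNc.closure).openSegment_subset (hNcl a ha hay) (hNcl b hb hby) hxab
    intro x hx hxy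
    have h1 : x ∈ interior (J ⁻¹' closure N) :=
      interior_maximal hsub (H.isOpen_left.inter isOpen_ball) ⟨hx, hxy⟩
    rw [← hNint]
    have h2 := J.toHomeomorph.preimage_interior (closure N)
    exact (h2 ▸ h1 : x ∈ J ⁻¹' interior (closure N))
  refine ⟨min r' s, lt_min hr' hs, fun x hx hxy => (hJN x hx (hxy.trans_le (min_le_left _ _))).1,
    fun z hz hzy x hx hxy => ?_⟩
  have h1 := hJN x hx (hxy.trans_le (min_le_left _ _))
  rw [hdist _ h1.1 (by linarith [h1.2]) z hz (hzy.trans_le (min_le_right _ _)),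
    J.isometry.dist_eq]

end LocalBoundaryIsometry

namespace LocalBoundaryIsometry

variable {E X : Type*} [NormedAddCommGroup E] [InnerProductSpace ℝ E] [FiniteDimensional ℝ E]
  [MetricSpace X] [CompleteSpace X] {U V : Set E} {ι : E → X} {p : X → E} {g : E → X} {y : E}

/-- A boundary point is regular if irregular points intrinsically close to it are close to it
in the Euclidean metric. -/
theorem exists_regularWith (hd : 1 < Module.finrank ℝ E) (H : LocalBoundaryIsometry U V ι p g)
    (hy : y ∈ frontier U)
    (hirr : ∀ ε > 0, ∃ ρ > 0, ∀ w ∈ frontier U, (¬∃ r J, RegularWith U V ι g w r J) →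
      dist (g w) (g y) < ρ → dist w y < ε) : ∃ r J, RegularWith U V ι g y r J := by
  obtain ⟨ε, hε, hiso⟩ := H.isom y hy
  obtain ⟨ρ, hρ, hirr⟩ := hirr ε hε
  have hgy : ∀ z ∈ frontier U, dist z y < ε → dist (g z) (g y) = dist z y := fun z hz hzy =>
    hiso z hz y hy hzy (by simpa using hε)
  obtain ⟨r, hr, hrε, hrρ⟩ : ∃ r > 0, r ≤ ε ∧ 8 * r ≤ ρ :=
    ⟨min ε (ρ / 8), lt_min hε (by positivity), min_le_left _ _,
      by linarith [min_le_right ε (ρ / 8)]⟩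
  have hchord : ∀ a ∈ frontier U, ∀ b ∈ frontier U, dist a y < r → dist b y < r → a ≠ b →
      dist (p (g a)) (p (g b)) = dist a b ∧ ∀ η > 0, ∃ v ∈ V,
        dist v (midpoint ℝ (p (g a)) (p (g b))) < η ∧ dist (ι v) (g a) ≤ 2 * dist a b := by
    intro a ha b hb hay hby hab
    refine H.dist_proj_eq ha hb hab (hiso a ha b hb (by linarith) (by linarith))
      fun w hw hwirr hwa => ?_
    have h1 := hgy a ha (by linarith)
    have h2 : dist w y < ε := hirr w hw hwirr (by
      linarith [dist_triangle (g w) (g a) (g y), dist_triangle_right a b y])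
    exact ⟨hiso w hw a ha h2 (by linarith), hiso w hw b hb h2 (by linarith)⟩
  obtain ⟨J, hJ⟩ := exists_isometryEquiv_eqOn (S := frontier U ∩ ball y r) (h := fun z => p (g z))
    (by
      intro a ha b hb
      rcases eq_or_ne a b with rfl | hab
      · simp
      · exact (hchord a ha.1 b hb.1 ha.2 hb.2 hab).1)
  have hJ' : ∀ z ∈ frontier U, dist z y < r → p (g z) = J z := fun z hz hzy =>
    (hJ ⟨hz, hzy⟩).symm
  obtain ⟨v₀, hv₀, hv₀U, hv₀y⟩ : ∃ v₀ ∈ V, J.symm v₀ ∈ U ∧ dist (ι v₀) (g y) < r / 3 := by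
    obtain ⟨r', hr', hcov⟩ := exists_forall_mem_openSegment hd H.isOpen_left H.convex
      H.openSegment_subset hy (r := r / 15) (by positivity)
    obtain ⟨x, hx, hxy⟩ := exists_mem_dist_lt_of_mem_frontier hy hr'
    obtain ⟨a, ha, b, hb, hay, hby, hab, -⟩ := hcov x hx hxy
    have har : dist a y < r := by linarith
    have hbr : dist b y < r := by linarith
    have hm : midpoint ℝ a b ∈ U := H.openSegment_subset a (frontier_subset_closure ha) b
      (frontier_subset_closure hb) hab (midpoint_mem_openSegment a b)
    obtain ⟨η, hη, hηU⟩ := Metric.isOpen_iff.1 H.isOpen_left _ hm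
    obtain ⟨v, hv, hvm, hva⟩ := (hchord a ha b hb har hbr hab).2 η hη
    refine ⟨v, hv, hηU ?_, ?_⟩
    · rwa [mem_ball, ← J.isometry.dist_eq, J.apply_symm_apply, J.map_midpoint, ← hJ' a ha har,
        ← hJ' b hb hbr]
    · linarith [dist_triangle (ι v) (g a) (g y), dist_triangle_right a b y,
        hgy a ha (by linarith)]
  have hnear : ∀ v ∈ V, dist (ι v) (g y) < r / 3 → J.symm v ∈ U := fun v hv hvy =>
    H.symm_mem_of_proj_eq hy hr hJ' hv₀ hv₀U hv₀y hv hvy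
  obtain ⟨ε₁, hε₁⟩ := H.regularWith_of_segment_subset hd hy (s := r / 9) (J := J) (by positivity)
    (fun z hz hzy => hJ' z hz (by linarith)) (fun z hz hzy => hgy z hz (by linarith)) (by
      intro v hv v' hv' hvy hvy'
      obtain ⟨ℓ, hℓ1, hℓ2⟩ : ∃ ℓ, dist (ι v) (ι v') < ℓ ∧ ℓ < 2 * r / 9 := exists_between (by
        linarith [dist_triangle_right (ι v) (ι v') (g y)])
      obtain ⟨hℓ, γ, hγ0, hγℓ, hγV, hγ⟩ := H.model.hasPath v hv v' hv' ℓ hℓ1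
      rw [← hγℓ]
      refine H.segment_subset hγ0 hγV hγ (K := J.symm ⁻¹' U) (J.symm.convex_preimage H.convex)
        (fun t ht => hnear _ (hγV t ht) ?_) (fun w hw hwv hwK => ?_) ⟨hℓ, le_rfl⟩
      · have h1 := H.model.dist_le _ _ _ (HasPath.restrict ht.1
          (fun τ hτ => hγV τ ⟨hτ.1, hτ.2.trans ht.2⟩) fun σ hσ τ hτ =>
          hγ σ ⟨hσ.1, hσ.2.trans ht.2⟩ τ ⟨hτ.1, hτ.2.trans ht.2⟩)
        rw [hγ0] at h1
        linarith [dist_triangle_left (ι (γ t)) (g y) (ι v), ht.2]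
      · by_contra hwirr
        have h1 : dist (g w) (g y) < r / 3 := by
          linarith [dist_triangle_left (g w) (g y) (ι v)]
        have h2 := hgy w hw (hirr w hw hwirr (by linarith))
        rw [hJ' w hw (by linarith), mem_preimage, J.symm_apply_apply] at hwK
        exact (H.isOpen_left.frontier_eq ▸ hw).2 hwK)
  exact ⟨ε₁, J, hε₁⟩

/-- Every boundary point is regular. -/
theorem exists_regularWith_of_mem_frontier (hd : 1 < Module.finrank ℝ E)
    (H : LocalBoundaryIsometry U V ι p g) (hy : y ∈ frontier U) :
    ∃ r J, RegularWith U V ι g y r J := by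
  have : ProperSpace E := FiniteDimensional.proper ℝ E
  by_contra hn
  obtain ⟨z, hz, h⟩ := exists_forall_dist_lt_of_isClosed_image
    (S := {w | w ∈ frontier U ∧ ¬∃ r J, RegularWith U V ι g w r J}) isClosed_irregular
    ⟨y, hy, hn⟩ (H.continuousOn.mono fun w hw => hw.1) (H.injOn.mono fun w hw => hw.1)
    H.isClosed_image_irregular
  refine hz.2 (H.exists_regularWith hd hz.1 fun ε hε => ?_)
  obtain ⟨ρ, hρ, h⟩ := h ε hε
  exact ⟨ρ, hρ, fun w hw hwirr => h w ⟨hw, hwirr⟩⟩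

theorem convex_right (hd : 1 < Module.finrank ℝ E) (H : LocalBoundaryIsometry U V ι p g) :
    Convex ℝ V := by
  refine convex_iff_segment_subset.2 fun v hv v' hv' => ?_
  obtain ⟨hℓ, γ, hγ0, hγℓ, hγV, hγ⟩ := H.model.hasPath v hv v' hv' _ (lt_add_one _)
  rw [← hγℓ]
  exact H.segment_subset hγ0 hγV hγ convex_univ (fun _ _ => mem_univ _)
    (fun w hw _ _ => H.exists_regularWith_of_mem_frontier hd hw) ⟨hℓ, le_rfl⟩

end LocalBoundaryIsometry

/-- Isometries agreeing on a nonempty open set are equal. -/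
theorem IsometryEquiv.eq_of_eqOn_isOpen {E F : Type*} [NormedAddCommGroup E] [NormedSpace ℝ E]
    [NormedAddCommGroup F] [NormedSpace ℝ F] {J J' : E ≃ᵢ F} {W : Set E} (hW : IsOpen W)
    (hne : W.Nonempty) (h : EqOn J J' W) : J = J' := by
  have h1 := AffineMap.ext_on (f := J.toRealAffineIsometryEquiv.toAffineEquiv.toAffineMap)
    (g := J'.toRealAffineIsometryEquiv.toAffineEquiv.toAffineMap) (hW.affineSpan_eq_top hne) h
  exact IsometryEquiv.ext fun x => congrArg (fun f : E →ᵃ[ℝ] F => f x) h1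

namespace LocalBoundaryIsometry

variable {E X : Type*} [NormedAddCommGroup E] [InnerProductSpace ℝ E] [FiniteDimensional ℝ E]
  [MetricSpace X] {U V : Set E} {ι : E → X} {p : X → E} {g : E → X} {y : E}

theorem eq_of_eqOn_frontier (hd : 1 < Module.finrank ℝ E) (H : LocalBoundaryIsometry U V ι p g)
    (hy : y ∈ frontier U) {r : ℝ} (hr : 0 < r) {J J' : E ≃ᵢ E}
    (h : EqOn J J' (frontier U ∩ ball y r)) : J = J' := by
  obtain ⟨r', hr', hcov⟩ := exists_forall_mem_openSegment hd H.isOpen_left H.convex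
    H.openSegment_subset hy hr
  obtain ⟨x, hx, hxy⟩ := exists_mem_dist_lt_of_mem_frontier hy hr'
  refine IsometryEquiv.eq_of_eqOn_isOpen (H.isOpen_left.inter isOpen_ball)
    ⟨x, hx, mem_ball.2 hxy⟩ ?_
  rintro x ⟨hx, hxy⟩
  obtain ⟨a, ha, b, hb, hay, hby, -, hxab⟩ := hcov x hx hxy
  rw [openSegment_eq_image_lineMap] at hxab
  obtain ⟨t, -, rfl⟩ := hxab
  have e : ∀ K : E ≃ᵢ E, K (AffineMap.lineMap a b t) = AffineMap.lineMap (K a) (K b) t :=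
    fun K => K.toRealAffineIsometryEquiv.toAffineEquiv.toAffineMap.apply_lineMap a b t
  rw [e, e, h ⟨ha, hay⟩, h ⟨hb, hby⟩]

variable [CompleteSpace X]

/-- The local isometries extending `g` fit together. -/
theorem exists_isometryEquiv_forall_regularWith (hd : 1 < Module.finrank ℝ E)
    (H : LocalBoundaryIsometry U V ι p g) :
    ∃ J : E ≃ᵢ E, ∀ y ∈ frontier U, ∃ r, RegularWith U V ι g y r J := by
  choose r J h using fun y : frontier U => H.exists_regularWith_of_mem_frontier hd y.2
  have hloc : IsLocallyConstant J := by
    refine (IsLocallyConstant.iff_eventually_eq J).2 fun y => ?_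
    filter_upwards [ball_mem_nhds y (h y).pos] with z hz
    have hz' : dist (z : E) y < r y := hz
    refine H.eq_of_eqOn_frontier hd z.2
      (lt_min (h z).pos ((h y).of_dist_lt hz').pos) fun w ⟨hw, hwz⟩ => ?_
    rw [← H.proj_eq (h z) hw (hwz.trans_le (min_le_left _ _)),
      ← H.proj_eq ((h y).of_dist_lt hz') hw (hwz.trans_le (min_le_right _ _))]
  have : PreconnectedSpace (frontier U) := Subtype.preconnectedSpace
    (isPreconnected_frontier_of_openSegment_subset hd H.isOpen_left H.convex H.openSegment_subset)
  obtain ⟨J₀, hJ₀⟩ : ∃ J₀, ∀ y, J y = J₀ := by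
    rcases isEmpty_or_nonempty (frontier U) with hE | ⟨⟨y₀⟩⟩
    · exact ⟨IsometryEquiv.refl E, fun y => hE.elim y⟩
    · exact ⟨J y₀, fun y => hloc.apply_eq_of_preconnectedSpace y y₀⟩
  exact ⟨J₀, fun y hy => ⟨r ⟨y, hy⟩, hJ₀ ⟨y, hy⟩ ▸ h ⟨y, hy⟩⟩⟩

/-- A strictly convex set is determined by its boundary up to isometry. -/
theorem exists_image_eq (hd : 1 < Module.finrank ℝ E) (H : LocalBoundaryIsometry U V ι p g)
    (hU : U.Nonempty) (hV : V.Nonempty) : ∃ J : E ≃ᵢ E, J '' U = V := by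
  have hVc := H.convex_right hd
  have hVf : ∀ q ∈ frontier V, ∃ z ∈ frontier U, p (g z) = q := by
    intro q hq
    obtain ⟨c, rfl, -⟩ := H.model.exists_proj_eq hVc subset_rfl (frontier_subset_closure hq)
    obtain ⟨z, hz, rfl⟩ := H.exists_eq c (H.isOpen_right.frontier_eq ▸ hq).2
    exact ⟨z, hz, rfl⟩
  obtain ⟨J, hJ⟩ := H.exists_isometryEquiv_forall_regularWith hd
  have hJp : ∀ z ∈ frontier U, p (g z) = J z := fun z hz => by
    obtain ⟨r, h⟩ := hJ z hz
    exact H.proj_eq h hz (by simpa using h.pos)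
  refine ⟨J, ?_⟩
  rcases (frontier U).eq_empty_or_nonempty with hUf | ⟨y, hy⟩
  · have hVf' : frontier V = ∅ := eq_empty_of_forall_notMem fun q hq => by
      obtain ⟨z, hz, -⟩ := hVf q hq
      simp [hUf] at hz
    rw [(frontier_eq_empty_iff.1 hUf).resolve_left hU.ne_empty,
      (frontier_eq_empty_iff.1 hVf').resolve_left hV.ne_empty, image_univ, J.surjective.range_eq]
  · obtain ⟨r, h⟩ := hJ y hy
    obtain ⟨x, hx, hxy⟩ := exists_mem_dist_lt_of_mem_frontier hy h.pos
    have hxV := h.mapsTo x hx hxy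
    have himage : J '' U = J.symm ⁻¹' U := J.toEquiv.image_eq_preimage_symm U
    refine Subset.antisymm ?_ ?_
    · refine (H.convex.isPreconnected.image J J.continuous.continuousOn).subset_of_disjoint_frontier
        H.isOpen_right ?_ ⟨J x, mem_image_of_mem J hx, hxV⟩
      rintro _ ⟨u, hu, rfl⟩ hq
      obtain ⟨z, hz, hzu⟩ := hVf _ hq
      rw [hJp z hz, J.injective.eq_iff] at hzu
      exact (H.isOpen_left.frontier_eq ▸ hz).2 (hzu ▸ hu)
    · rw [himage]
      refine hVc.isPreconnected.subset_of_disjoint_frontier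
        (H.isOpen_left.preimage J.symm.continuous) (fun q hq hqf => ?_)
        ⟨J x, hxV, by simpa⟩
      rw [J.frontier_preimage_symm] at hqf
      refine H.proj_notMem _ hqf ?_
      rwa [hJp _ hqf, J.apply_symm_apply]

end LocalBoundaryIsometry

theorem IntrinsicModel.dist_proj {E X : Type*} [NormedAddCommGroup E] [NormedSpace ℝ E]
    [MetricSpace X] {U : Set E} {ι : E → X} {p : X → E} (M : IntrinsicModel U ι p)
    (hU : Convex ℝ U) (ξ η : X) : dist (p ξ) (p η) = dist ξ η := by
  refine (M.dist_proj_le ξ η).antisymm (le_of_forall_pos_le_add fun ε hε => ?_)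
  obtain ⟨x, hx, hxξ⟩ := M.dense ξ (ε / 4) (by positivity)
  obtain ⟨y, hy, hyη⟩ := M.dense η (ε / 4) (by positivity)
  have h1 := M.dist_incl (hU.segment_subset hx hy)
  have h2 := M.dist_proj_le (ι x) ξ
  have h3 := M.dist_proj_le (ι y) η
  rw [M.proj_incl x hx] at h2
  rw [M.proj_incl y hy] at h3
  linarith [dist_triangle4_left (ι x) (ι y) ξ η, dist_triangle4_right x y (p ξ) (p η)]

theorem exists_localBoundaryIsometry {n : ℕ} {U V : Set (EuclideanSpace ℝ (Fin n))}
    (hU : IsDomainSet U) (hUc : IsStrictlyConvexDomain U) (hV : IsDomainSet V)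
    {f : HPoint U → HPoint V} (hf : HBoundaryLocalIsometry f) :
    ∃ (X : Type) (_ : MetricSpace X) (_ : CompleteSpace X) (ι : EuclideanSpace ℝ (Fin n) → X)
      (p : X → EuclideanSpace ℝ (Fin n)) (g : EuclideanSpace ℝ (Fin n) → X),
      LocalBoundaryIsometry U V ι p g := by
  obtain ⟨hf0, hfs, hfi⟩ := hf
  obtain ⟨X', _, _, ι', p', τ', M', hτ', hτ'mem⟩ := exists_intrinsicModel hU
  obtain ⟨X, _, _, ι, p, τ, M, hτ, hτmem⟩ := exists_intrinsicModel hV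
  have hzero' : ∀ a b, hDist a b = 0 ↔ τ' a = τ' b := fun a b => by rw [hτ', edist_eq_zero]
  have hzero : ∀ a b, hDist a b = 0 ↔ τ a = τ b := fun a b => by rw [hτ, edist_eq_zero]
  have hinj : ∀ a b, τ' a = τ' b ↔ τ (f a) = τ (f b) := fun a b => by
    rw [← hzero', ← hzero, hf0]
  have hproj : ∀ a b, p' (τ' a) = p' (τ' b) ↔ τ' a = τ' b := fun a b => by
    rw [← dist_eq_zero, M'.dist_proj hUc.1, dist_eq_zero]
  have hfr : ∀ a, p' (τ' a) ∈ frontier U := fun a => by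
    rw [hU.1.frontier_eq]
    refine ⟨Metric.mem_closure_iff.2 fun ε hε => ?_, fun h => ?_⟩
    · obtain ⟨x, hx, h⟩ := M'.dense (τ' a) ε hε
      refine ⟨x, hx, ?_⟩
      rw [dist_comm, ← M'.proj_incl x hx]
      exact (M'.dist_proj_le _ _).trans_lt h
    · exact (hτ'mem _).1 ⟨a, rfl⟩ ((M'.proj_mem_iff hU.1).1 h)
  have hex : ∀ z, ∃ ξ, z ∈ frontier U → ∃ a, p' (τ' a) = z ∧ τ (f a) = ξ := by
    intro z
    by_cases hz : z ∈ frontier U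
    · obtain ⟨c, hc, -⟩ := M'.exists_proj_eq hUc.1 subset_rfl (frontier_subset_closure hz)
      obtain ⟨a, ha⟩ := (hτ'mem c).2 fun h => by
        rw [← M'.proj_mem_iff hU.1, hc] at h
        exact (hU.1.frontier_eq ▸ hz).2 h
      exact ⟨_, fun _ => ⟨a, by rw [ha, hc], rfl⟩⟩
    · exact ⟨ι 0, fun h => absurd h hz⟩
  choose g hg using hex
  have hga : ∀ a, g (p' (τ' a)) = τ (f a) := fun a => by
    obtain ⟨b, hb, hb'⟩ := hg _ (hfr a)
    rw [← hb', ← hinj, ← hproj, hb]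
  have hpar : ∀ z ∈ frontier U, ∃ a, p' (τ' a) = z := fun z hz => by
    obtain ⟨a, ha, -⟩ := hg z hz
    exact ⟨a, ha⟩
  have hdist' : ∀ a b, hDist a b = edist (p' (τ' a)) (p' (τ' b)) := fun a b => by
    rw [hτ', edist_dist, edist_dist, M'.dist_proj hUc.1]
  refine ⟨X, _, inferInstance, ι, p, g, M, hU.1, hUc.1, hUc.2, hV.1, ?_, ?_, ?_, ?_⟩
  · intro z hz w hw h
    obtain ⟨a, rfl⟩ := hpar z hz
    obtain ⟨b, rfl⟩ := hpar w hw
    rwa [hga, hga, ← hinj, ← hproj] at h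
  · intro z hz
    obtain ⟨a, rfl⟩ := hpar z hz
    rw [hga, M.proj_mem_iff hV.1]
    exact (hτmem _).1 ⟨_, rfl⟩
  · intro ξ hξ
    rw [M.proj_mem_iff hV.1] at hξ
    obtain ⟨b, rfl⟩ := (hτmem ξ).2 hξ
    obtain ⟨a, ha⟩ := hfs b
    exact ⟨_, hfr a, by rw [hga, (hzero _ _).1 ha]⟩
  · intro y hy
    obtain ⟨a, rfl⟩ := hpar y hy
    obtain ⟨ε, hε, h⟩ := hfi a
    obtain ⟨δ, hδ, hδε⟩ := ENNReal.lt_iff_exists_nnreal_btwn.1 hε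
    refine ⟨δ, by exact_mod_cast hδ, fun z hz w hw hzy hwy => ?_⟩
    obtain ⟨b, rfl⟩ := hpar z hz
    obtain ⟨c, rfl⟩ := hpar w hw
    have h1 := h b c ?_ ?_
    · rw [hga, hga, dist_edist, dist_edist, ← hdist', h1, hτ]
    · rw [hdist']
      exact (edist_lt_coe.2 hzy).trans hδε
    · rw [hdist']
      exact (edist_lt_coe.2 hwy).trans hδε

/-- a strictly convex domain in `ℝⁿ` (`n ≥ 2`) is uniquely
determined in the class of all domains in `ℝⁿ` by the condition of local
isometry of the Hausdorff boundaries in the relative metrics. -/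
theorem strictly_convex_uniquely_determined
    (n : ℕ) (hn : 2 ≤ n)
    (U : Set (EuclideanSpace ℝ (Fin n)))
    (hU : IsDomainSet U) (hUconv : IsStrictlyConvexDomain U) :
    ∀ V : Set (EuclideanSpace ℝ (Fin n)), IsDomainSet V →
      (∃ f : HPoint U → HPoint V, HBoundaryLocalIsometry f) →
      ∃ J : EuclideanSpace ℝ (Fin n) ≃ᵢ EuclideanSpace ℝ (Fin n), J '' U = V := by
  rintro V hV ⟨f, hf⟩
  obtain ⟨X, _, _, ι, p, g, H⟩ := exists_localBoundaryIsometry hU hUconv hV hf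
  exact H.exists_image_eq (by rwa [finrank_euclideanSpace_fin]) hU.2.nonempty hV.2.nonempty

end
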